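/- arXiv:1111.7109 — 2 statements merged into one kernel-verified Lean document; each statement's English description precedes it below -/
import Mathlib

section
/- A permutation f of P preserves the relation Pari if and only if f is a rotation of P or f is the composition s ∘ r of an anti-automorphism s of P with a rotation r of P. -/
variable {P : Type} [PartialOrder P]

/-- `a` and `b` are incomparable elements of the partial order `P`. -/
def Perp (a b : P) : Prop := ¬ a ≤ b ∧ ¬ b ≤ a

/-- `f` is an order-automorphism of `P`. -/
def IsOrderAuto (f : Equiv.Perm P) : Prop := ∀ a b : P, f a ≤ f b ↔ a ≤ b

/-- `f` is an anti-automorphism of `P`. -/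
def IsAntiAuto (f : Equiv.Perm P) : Prop := ∀ a b : P, f a ≤ f b ↔ b ≤ a

/-- Every finite partial order embeds into `P` (universality). -/
def IsUniversal (P : Type) [PartialOrder P] : Prop :=
  ∀ (Q : Type) [PartialOrder Q] [Fintype Q], Nonempty (Q ↪o P)

/-- Every order-isomorphism between two finite subsets of `P` extends to an
order-automorphism of `P` (homogeneity). -/
def IsHomogeneous (P : Type) [PartialOrder P] : Prop :=
  ∀ (S T : Finset P) (e : (S : Set P) ≃o (T : Set P)),
    ∃ g : P ≃o P, ∀ x : (S : Set P), g ↑x = ↑(e x)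

/-- A subgroup of `Sym(P)` is closed iff it contains every permutation that agrees
with one of its members on each finite subset of `P`. -/
def IsClosedSubgroup (G : Subgroup (Equiv.Perm P)) : Prop :=
  ∀ f : Equiv.Perm P,
    (∀ S : Finset P, ∃ g ∈ G, ∀ x ∈ S, (g : Equiv.Perm P) x = f x) → f ∈ G

/-- `h` is an order-automorphism of `P` fixing each of the constants `c i`. -/
def FixingAuto (n : ℕ) (c : Fin n → P) (h : Equiv.Perm P) : Prop :=
  IsOrderAuto h ∧ ∀ i : Fin n, h (c i) = c i

/-- `X` is an orbit of `(P, c₁, …, cₙ)`, i.e. an orbit of the action on `P` of the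
group of automorphisms of `P` fixing each `c i`. -/
def IsOrbit (n : ℕ) (c : Fin n → P) (X : Set P) : Prop :=
  ∃ x : P, X = {y | ∃ h : Equiv.Perm P, FixingAuto n c h ∧ h x = y}

/-- `g` is canonical as a function from `(P, c₁, …, cₙ)` to `P`. -/
def Canonical (n : ℕ) (c : Fin n → P) (g : P → P) : Prop :=
  ∀ (m : ℕ) (a b : Fin m → P),
    (∃ h : Equiv.Perm P, FixingAuto n c h ∧ ∀ j : Fin m, h (a j) = b j) →
    ∃ h' : Equiv.Perm P, IsOrderAuto h' ∧ ∀ j : Fin m, h' (g (a j)) = g (b j)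

/-- `g` is M-generated by the subgroup `G` of `Sym(P)`: on every finite subset of `P`
it agrees with some member of `G`. -/
def MGen (G : Subgroup (Equiv.Perm P)) (g : P → P) : Prop :=
  ∀ S : Finset P, ∃ h ∈ G, ∀ x ∈ S, (h : Equiv.Perm P) x = g x

/-- `g` behaves like `id` on `X`. -/
def BehavesLikeId (g : P → P) (X : Set P) : Prop :=
  ∀ x ∈ X, ∀ x' ∈ X, (x < x' → g x < g x') ∧ (Perp x x' → Perp (g x) (g x'))

/-- `g` behaves like `↕` on `X`. -/
def BehavesLikeRev (g : P → P) (X : Set P) : Prop :=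
  ∀ x ∈ X, ∀ x' ∈ X, (x < x' → g x' < g x) ∧ (Perp x x' → Perp (g x) (g x'))

/-- `g` behaves like `id` between `X` and `Y`. -/
def BehavesLikeIdBetween (g : P → P) (X Y : Set P) : Prop :=
  ∀ x ∈ X, ∀ y ∈ Y,
    (x < y → g x < g y) ∧ (y < x → g y < g x) ∧ (Perp x y → Perp (g x) (g y))

/-- `X ≤ Y` for subsets: some element of `X` lies below some element of `Y`. -/
def SetLE (X Y : Set P) : Prop := ∃ x ∈ X, ∃ y ∈ Y, x ≤ y

/-- `X < Y` for subsets: every element of `X` lies strictly below every element of `Y`. -/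
def SetLT (X Y : Set P) : Prop := ∀ x ∈ X, ∀ y ∈ Y, x < y

/-- The relation `X ÷ Y`. -/
def SetDiv (X Y : Set P) : Prop :=
  (SetLE X Y ∧ ¬ SetLE Y X ∧ ¬ SetLT X Y) ∨ (SetLE Y X ∧ ¬ SetLE X Y ∧ ¬ SetLT Y X)

/-- `f` is a rotation of `P`. -/
def IsRotation (f : Equiv.Perm P) : Prop :=
  ∃ X Y Z : Set P,
    (∀ p : P, p ∈ X ∨ p ∈ Y ∨ p ∈ Z) ∧
    Disjoint X Y ∧ Disjoint X Z ∧ Disjoint Y Z ∧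
    IsLowerSet X ∧ IsUpperSet Z ∧
    (∀ x ∈ X, ∀ z ∈ Z, x < z) ∧
    BehavesLikeId (⇑f) X ∧ BehavesLikeId (⇑f) Y ∧ BehavesLikeId (⇑f) Z ∧
    (∀ x ∈ X, ∀ z ∈ Z, f z < f x) ∧
    (∀ x ∈ X, ∀ y ∈ Y, (f y < f x ↔ Perp x y) ∧ (Perp (f x) (f y) ↔ x < y)) ∧
    (∀ y ∈ Y, ∀ z ∈ Z, (f z < f y ↔ Perp y z) ∧ (Perp (f y) (f z) ↔ y < z))

/-- The ternary relation `Cyc`. -/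
def Cyc (a b c : P) : Prop :=
  (a < b ∧ b < c) ∨ (b < c ∧ c < a) ∨ (c < a ∧ a < b) ∨
  (a < b ∧ Perp c a ∧ Perp c b) ∨ (b < c ∧ Perp a b ∧ Perp a c) ∨
  (c < a ∧ Perp b a ∧ Perp b c)

/-- The ternary relation `Cyc'`, the dual of `Cyc`. -/
def Cyc' (a b c : P) : Prop := Cyc c b a

/-- The ternary relation `Pari`. -/
def Pari (a b c : P) : Prop :=
  (Perp a b ∧ Perp b c ∧ Perp a c) ∨
  (a < b ∧ a < c ∧ Perp b c) ∨ (b < a ∧ b < c ∧ Perp a c) ∨ (c < a ∧ c < b ∧ Perp a b) ∨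
  (b < a ∧ c < a ∧ Perp b c) ∨ (a < b ∧ c < b ∧ Perp a c) ∨ (a < c ∧ b < c ∧ Perp a b)

/-- `f` preserves the ternary relation `R`. -/
def Preserves3 (f : P → P) (R : P → P → P → Prop) : Prop :=
  ∀ a b c : P, R a b c ↔ R (f a) (f b) (f c)

section Cocycle

open Classical in
/-- The order type of a pair as an element of `ZMod 3`: `1` for `a < b`, `-1` for `b < a`
and `0` otherwise. -/
noncomputable def cmp3 (a b : P) : ZMod 3 := if a < b then 1 else if b < a then -1 else 0

theorem cmp3_eq_one {a b : P} : cmp3 a b = 1 ↔ a < b := by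
  unfold cmp3
  split_ifs with h1 h2
  · simp [h1]
  · simp only [h1, iff_false]; decide
  · simp [h1]

theorem cmp3_swap (a b : P) : cmp3 b a = -cmp3 a b := by
  unfold cmp3
  split_ifs with h1 h2 h2
  · exact absurd (h1.trans h2) (lt_irrefl _)
  all_goals simp

theorem cmp3_eq_neg_one {a b : P} : cmp3 a b = -1 ↔ b < a := by
  rw [cmp3_swap b a, neg_inj, cmp3_eq_one]

theorem cmp3_trans {a b c : P} (hab : cmp3 a b = 1) (hbc : cmp3 b c = 1) : cmp3 c a = -1 :=
  cmp3_eq_neg_one.2 ((cmp3_eq_one.1 hab).trans (cmp3_eq_one.1 hbc))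

theorem cmp3_trans_neg {a b c : P} (hab : cmp3 a b = -1) (hbc : cmp3 b c = -1) :
    cmp3 c a = 1 :=
  cmp3_eq_one.2 ((cmp3_eq_neg_one.1 hbc).trans (cmp3_eq_neg_one.1 hab))

theorem cmp3_self (a : P) : cmp3 a a = 0 := by simp [cmp3]

theorem Perp.symm {a b : P} (h : Perp a b) : Perp b a := ⟨h.2, h.1⟩

theorem Perp.ne {a b : P} (h : Perp a b) : a ≠ b := fun e => h.1 e.le

theorem Perp.cmp3_eq {a b : P} (h : Perp a b) : cmp3 a b = 0 := by
  rw [cmp3, if_neg fun h' => h.1 h'.le, if_neg fun h' => h.2 h'.le]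

theorem lt_or_gt_or_eq_or_perp (a b : P) : a < b ∨ b < a ∨ a = b ∨ Perp a b := by
  unfold Perp
  by_cases h1 : a ≤ b
  · rcases h1.lt_or_eq with h | h <;> simp [h]
  · by_cases h2 : b ≤ a
    · rcases h2.lt_or_eq with h | h <;> simp [h]
    · simp [h1, h2]

theorem perp_of_cmp3_eq_zero {a b : P} (h : cmp3 a b = 0) (hab : a ≠ b) : Perp a b := by
  rcases lt_or_gt_or_eq_or_perp a b with h' | h' | h' | h'
  · rw [cmp3_eq_one.2 h'] at h; exact absurd h (by decide)
  · rw [cmp3_eq_neg_one.2 h'] at h; exact absurd h (by decide)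
  · exact absurd h' hab
  · exact h'

theorem cmp3_cases (a b : P) : cmp3 a b = 1 ∨ cmp3 a b = -1 ∨ cmp3 a b = 0 := by
  generalize cmp3 a b = t
  revert t
  decide

/-- The coboundary of `cmp3`. -/
noncomputable def cob3 (a b c : P) : ZMod 3 := cmp3 a b + cmp3 b c + cmp3 c a

theorem cob3_cocycle (a b c d : P) :
    cob3 b c d - cob3 a c d + cob3 a b d - cob3 a b c = 0 := by
  unfold cob3
  rw [cmp3_swap b d, cmp3_swap a d, cmp3_swap a c]
  ring

theorem cob3_of_perp {a b x : P} (ha : Perp x a) (hb : Perp x b) : cob3 a b x = cmp3 a b := by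
  simp [cob3, ha.cmp3_eq, hb.symm.cmp3_eq]

theorem pari_iff (a b c : P) :
    Pari a b c ↔ a ≠ b ∧ b ≠ c ∧ a ≠ c ∧ cob3 a b c = 0 := by
  have e1 : (1 : ZMod 3) ≠ 0 := by decide
  have e2 : (-1 : ZMod 3) ≠ 0 := by decide
  have e3 : (1 + 1 : ZMod 3) = -1 := by decide
  have e4 : (-1 + -1 : ZMod 3) = 1 := by decide
  unfold Pari cob3 cmp3 Perp
  rcases lt_or_gt_or_eq_or_perp a b with h1 | h1 | h1 | ⟨h1, h1'⟩ <;>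
  rcases lt_or_gt_or_eq_or_perp b c with h2 | h2 | h2 | ⟨h2, h2'⟩ <;>
  rcases lt_or_gt_or_eq_or_perp a c with h3 | h3 | h3 | ⟨h3, h3'⟩ <;>
  grind

end Cocycle

section Extension

theorem exists_orderIso_apply_eq (hH : IsHomogeneous P) (T : Finset P)
    (j : (T : Set P) ↪o P) : ∃ g : P ≃o P, ∀ x, g (j x) = x := by
  classical
  have hS : (Set.range j) = ((Finset.univ.image j : Finset P) : Set P) := by simp
  let i : (T : Set P) ≃o ((Finset.univ.image j : Finset P) : Set P) :=
    j.orderIso.trans (OrderIso.setCongr _ _ hS)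
  obtain ⟨g, hg⟩ := hH _ _ i.symm
  refine ⟨g, fun x => ?_⟩
  have := hg (i x)
  rw [OrderIso.symm_apply_apply] at this
  exact this

/-- The one-point extension property of the random partial order. -/
def HasExtensions (P : Type) [PartialOrder P] : Prop :=
  ∀ A B C : Finset P, (∀ a ∈ A, ∀ b ∈ B, a < b) → (∀ c ∈ C, ∀ a ∈ A, ¬ c ≤ a) →
    (∀ c ∈ C, ∀ b ∈ B, ¬ b ≤ c) →
    ∃ p : P, (∀ a ∈ A, a < p) ∧ (∀ b ∈ B, p < b) ∧ ∀ c ∈ C, Perp p c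

theorem hasExtensions (hU : IsUniversal P) (hH : IsHomogeneous P) : HasExtensions P := by
  classical
  intro A B C hAB hCA hCB
  let T : Finset P := A ∪ B ∪ C
  let F := ((T : Set P) : Type)
  obtain ⟨e⟩ := hU (Finset (Option F))
  let φ : F → Finset (Option F) := fun x =>
    Finset.univ.filter fun o => o.elim (∃ b ∈ B, b ≤ x.1) (fun y => y ≤ x)
  let ψ : Finset (Option F) :=
    Finset.univ.filter fun o => o.elim True (fun y => ∃ a ∈ A, y.1 ≤ a)
  have hφn : ∀ x, none ∈ φ x ↔ ∃ b ∈ B, b ≤ x.1 := fun x => by simp [φ]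
  have hφs : ∀ x y, some y ∈ φ x ↔ y ≤ x := fun x y => by simp [φ]
  have hψn : none ∈ ψ := by simp [ψ]
  have hψs : ∀ y, some y ∈ ψ ↔ ∃ a ∈ A, y.1 ≤ a := fun y => by simp [ψ]
  have hφ : ∀ x y, φ x ≤ φ y ↔ x ≤ y := by
    intro x y
    constructor
    · intro h
      exact (hφs y x).1 (h ((hφs x x).2 le_rfl))
    · intro h o ho
      cases o with
      | none =>
        obtain ⟨b, hb, hbx⟩ := (hφn x).1 ho
        exact (hφn y).2 ⟨b, hb, hbx.trans h⟩
      | some z => exact (hφs y z).2 (((hφs x z).1 ho).trans h)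
  obtain ⟨g, hg⟩ := exists_orderIso_apply_eq hH T
    ((OrderEmbedding.ofMapLEIff φ hφ).trans e)
  have hg' : ∀ x : F, g (e (φ x)) = x.1 := hg
  have hlow : ∀ x : F, x.1 ≤ g (e ψ) ↔ φ x ≤ ψ := fun x => by
    rw [← hg' x, g.le_iff_le, e.le_iff_le]
  have hup : ∀ x : F, g (e ψ) ≤ x.1 ↔ ψ ≤ φ x := fun x => by
    rw [← hg' x, g.le_iff_le, e.le_iff_le]
  have mA : ∀ a ∈ A, a ∈ (T : Set P) := fun a ha => by simp [T, ha]
  have mB : ∀ b ∈ B, b ∈ (T : Set P) := fun b hb => by simp [T, hb]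
  have mC : ∀ c ∈ C, c ∈ (T : Set P) := fun c hc => by simp [T, hc]
  refine ⟨g (e ψ), fun a ha => lt_of_le_not_ge ((hlow ⟨a, mA a ha⟩).2 ?_) fun h => ?_,
    fun b hb => lt_of_le_not_ge ((hup ⟨b, mB b hb⟩).2 ?_) fun h => ?_,
    fun c hc => ⟨fun h => ?_, fun h => ?_⟩⟩
  · intro o ho
    cases o with
    | none => exact hψn
    | some z => exact (hψs z).2 ⟨a, ha, (hφs _ z).1 ho⟩
  · obtain ⟨b, hb, hba⟩ := (hφn _).1 ((hup ⟨a, mA a ha⟩).1 h hψn)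
    exact (hAB a ha b hb).not_ge hba
  · intro o ho
    cases o with
    | none => exact (hφn _).2 ⟨b, hb, le_rfl⟩
    | some z =>
      obtain ⟨a, ha, hza⟩ := (hψs z).1 ho
      exact (hφs _ z).2 (hza.trans (hAB a ha b hb).le)
  · obtain ⟨a, ha, hba⟩ := (hψs _).1 ((hlow ⟨b, mB b hb⟩).1 h ((hφs _ _).2 le_rfl))
    exact (hAB a ha b hb).not_ge hba
  · obtain ⟨b, hb, hbc⟩ := (hφn _).1 ((hup ⟨c, mC c hc⟩).1 h hψn)
    exact hCB c hc b hb hbc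
  · obtain ⟨a, ha, hca⟩ := (hψs _).1 ((hlow ⟨c, mC c hc⟩).1 h ((hφs _ _).2 le_rfl))
    exact hCA c hc a ha hca

theorem HasExtensions.exists_perp (hE : HasExtensions P) (C : Finset P) :
    ∃ p : P, ∀ c ∈ C, Perp p c := by
  obtain ⟨p, -, -, hp⟩ := hE ∅ ∅ C (by simp) (by simp) (by simp)
  exact ⟨p, hp⟩

end Extension

section AntiAutomorphism

/-- Finite order-reversing partial bijections of `P`. -/
def PartialAnti (P : Type) [PartialOrder P] : Type :=
  {s : Finset (P × P) // ∀ p ∈ s, ∀ q ∈ s, p.1 ≤ q.1 ↔ q.2 ≤ p.2}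

instance : Preorder (PartialAnti P) := Subtype.preorder _

theorem PartialAnti.exists_extend_fst (hE : HasExtensions P) (s : PartialAnti P) (a : P) :
    ∃ t : PartialAnti P, (∃ b, (a, b) ∈ t.1) ∧ s ≤ t := by
  classical
  by_cases ha : ∃ b, (a, b) ∈ s.1
  · exact ⟨s, ha, le_rfl⟩
  obtain ⟨b, hA, hB, hC⟩ := hE ((s.1.filter fun q => a < q.1).image Prod.snd)
    ((s.1.filter fun q => q.1 < a).image Prod.snd)
    ((s.1.filter fun q => Perp q.1 a).image Prod.snd)
    (by
      simp only [Finset.mem_image, Finset.mem_filter]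
      rintro _ ⟨q, ⟨hq, haq⟩, rfl⟩ _ ⟨r, ⟨hr, har⟩, rfl⟩
      have h := har.trans haq
      exact lt_of_le_not_ge ((s.2 r hr q hq).1 h.le) fun h' => h.not_ge ((s.2 q hq r hr).2 h'))
    (by
      simp only [Finset.mem_image, Finset.mem_filter]
      rintro _ ⟨q, ⟨hq, haq⟩, rfl⟩ _ ⟨r, ⟨hr, har⟩, rfl⟩ h
      exact haq.2 (har.le.trans ((s.2 r hr q hq).2 h)))
    (by
      simp only [Finset.mem_image, Finset.mem_filter]
      rintro _ ⟨q, ⟨hq, haq⟩, rfl⟩ _ ⟨r, ⟨hr, har⟩, rfl⟩ h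
      exact haq.1 (((s.2 q hq r hr).2 h).trans har.le))
  have key : ∀ q ∈ s.1, (a ≤ q.1 ↔ q.2 ≤ b) ∧ (q.1 ≤ a ↔ b ≤ q.2) := by
    intro q hq
    rcases lt_or_gt_or_eq_or_perp a q.1 with h | h | h | h
    · have h' := hA q.2 (Finset.mem_image_of_mem _ (Finset.mem_filter.2 ⟨hq, h⟩))
      simp [h.le, h'.le, h.not_ge, h'.not_ge]
    · have h' := hB q.2 (Finset.mem_image_of_mem _ (Finset.mem_filter.2 ⟨hq, h⟩))
      simp [h.le, h'.le, h.not_ge, h'.not_ge]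
    · exact absurd ⟨q.2, h ▸ hq⟩ ha
    · have h' := hC q.2 (Finset.mem_image_of_mem _ (Finset.mem_filter.2 ⟨hq, h.symm⟩))
      simp [h.1, h.2, h'.1, h'.2]
  refine ⟨⟨insert (a, b) s.1, ?_⟩, ⟨b, Finset.mem_insert_self _ _⟩,
    Finset.subset_insert _ _⟩
  intro p hp q hq
  rcases Finset.mem_insert.1 hp with rfl | hp <;> rcases Finset.mem_insert.1 hq with rfl | hq
  · simp
  · exact (key q hq).1
  · exact (key p hp).2
  · exact s.2 p hp q hq

/-- The inverse of a finite order-reversing partial bijection. -/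
def PartialAnti.swap (s : PartialAnti P) : PartialAnti P :=
  ⟨s.1.map (Equiv.prodComm P P).toEmbedding, by
    simp only [Finset.mem_map_equiv]
    intro p hp q hq
    exact (s.2 _ hq _ hp).symm⟩

theorem PartialAnti.mem_swap {s : PartialAnti P} {a b : P} :
    (a, b) ∈ s.swap.1 ↔ (b, a) ∈ s.1 := Finset.mem_map_equiv

theorem PartialAnti.exists_extend_snd (hE : HasExtensions P) (s : PartialAnti P) (b : P) :
    ∃ t : PartialAnti P, (∃ a, (a, b) ∈ t.1) ∧ s ≤ t := by
  obtain ⟨t, ⟨a, ha⟩, hst⟩ := s.swap.exists_extend_fst hE b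
  refine ⟨t.swap, ⟨a, mem_swap.2 ha⟩, ?_⟩
  rintro ⟨x, y⟩ hxy
  exact mem_swap.2 (hst (mem_swap.2 hxy))

theorem exists_isAntiAuto [Countable P] (hE : HasExtensions P) :
    ∃ s : Equiv.Perm P, IsAntiAuto s := by
  obtain ⟨_⟩ := nonempty_encodable P
  let D : P ⊕ P → Order.Cofinal (PartialAnti P) := fun p => p.elim
    (fun a => ⟨{t | ∃ b, (a, b) ∈ t.1}, fun s => s.exists_extend_fst hE a⟩)
    (fun b => ⟨{t | ∃ a, (a, b) ∈ t.1}, fun s => s.exists_extend_snd hE b⟩)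
  let I : Order.Ideal (PartialAnti P) := Order.idealOfCofinals ⟨∅, by simp⟩ D
  have hF : ∀ a, ∃ b, ∃ t ∈ I, (a, b) ∈ t.1 := fun a => by
    obtain ⟨t, ⟨b, hb⟩, ht⟩ := Order.cofinal_meets_idealOfCofinals ⟨∅, by simp⟩ D (Sum.inl a)
    exact ⟨b, t, ht, hb⟩
  have hG : ∀ b, ∃ a, ∃ t ∈ I, (a, b) ∈ t.1 := fun b => by
    obtain ⟨t, ⟨a, ha⟩, ht⟩ := Order.cofinal_meets_idealOfCofinals ⟨∅, by simp⟩ D (Sum.inr b)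
    exact ⟨a, t, ht, ha⟩
  have hI : ∀ p q : P × P, (∃ t ∈ I, p ∈ t.1) → (∃ t ∈ I, q ∈ t.1) →
      (p.1 ≤ q.1 ↔ q.2 ≤ p.2) := by
    rintro p q ⟨t, ht, hp⟩ ⟨u, hu, hq⟩
    obtain ⟨v, -, htv, huv⟩ := I.directed t ht u hu
    exact v.2 p (htv hp) q (huv hq)
  choose F hF using hF
  choose G hG using hG
  refine ⟨⟨F, G, fun a => ?_, fun b => ?_⟩, fun a b => ?_⟩
  · exact le_antisymm ((hI _ _ (hG (F a)) (hF a)).2 le_rfl)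
      ((hI _ _ (hF a) (hG (F a))).2 le_rfl)
  · exact le_antisymm ((hI _ _ (hG b) (hF (G b))).1 le_rfl)
      ((hI _ _ (hF (G b)) (hG b)).1 le_rfl)
  · exact (hI _ _ (hF b) (hF a)).symm

end AntiAutomorphism

section Preservation

theorem preserves3_pari_of_cob3 (f : Equiv.Perm P)
    (h : ∀ a b c : P, cob3 (f a) (f b) (f c) = 0 ↔ cob3 a b c = 0) : Preserves3 f Pari := by
  intro a b c
  rw [pari_iff, pari_iff, h, f.injective.ne_iff, f.injective.ne_iff, f.injective.ne_iff]

theorem cob3_map_eq_zero_iff {f : Equiv.Perm P} (hf : Preserves3 f Pari) (a b c : P) :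
    cob3 (f a) (f b) (f c) = 0 ↔ cob3 a b c = 0 := by
  have deg : ∀ a b c : P, a = b ∨ b = c ∨ a = c → cob3 a b c = 0 := by
    rintro a b c (rfl | rfl | rfl)
    · simp [cob3, cmp3_self, cmp3_swap a c]
    · simp [cob3, cmp3_self, cmp3_swap a b]
    · simp [cob3, cmp3_self, cmp3_swap a b]
  by_cases hd : a = b ∨ b = c ∨ a = c
  · have hd' : f a = f b ∨ f b = f c ∨ f a = f c := by simpa using hd
    rw [deg _ _ _ hd, deg _ _ _ hd']
  · push Not at hd
    have := hf a b c
    rw [pari_iff, pari_iff, f.injective.ne_iff, f.injective.ne_iff, f.injective.ne_iff] at this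
    simpa [hd] using this.symm

theorem IsAntiAuto.cmp3_map {s : Equiv.Perm P} (hs : IsAntiAuto s) (a b : P) :
    cmp3 (s a) (s b) = -cmp3 a b := by
  rw [← cmp3_swap]
  have hlt : ∀ x y, s x < s y ↔ y < x := fun x y => by
    rw [lt_iff_le_not_ge, lt_iff_le_not_ge, hs, hs]
  unfold cmp3
  rw [hlt a b, hlt b a]

theorem IsAntiAuto.symm {s : Equiv.Perm P} (hs : IsAntiAuto s) :
    IsAntiAuto (s⁻¹ : Equiv.Perm P) := by
  intro a b
  simpa using (hs (s⁻¹ b) (s⁻¹ a)).symm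

theorem IsAntiAuto.cob3_map {s : Equiv.Perm P} (hs : IsAntiAuto s) (a b c : P) :
    cob3 (s a) (s b) (s c) = -cob3 a b c := by
  simp only [cob3, hs.cmp3_map]
  ring

theorem BehavesLikeId.cmp3_map {f : P → P} {X : Set P} (h : BehavesLikeId f X) {x y : P}
    (hx : x ∈ X) (hy : y ∈ X) : cmp3 (f x) (f y) = cmp3 x y := by
  rcases lt_or_gt_or_eq_or_perp x y with h' | h' | rfl | h'
  · rw [cmp3_eq_one.2 h', cmp3_eq_one.2 ((h x hx y hy).1 h')]
  · rw [cmp3_eq_neg_one.2 h', cmp3_eq_neg_one.2 ((h y hy x hx).1 h')]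
  · rw [cmp3_self, cmp3_self]
  · rw [h'.cmp3_eq, ((h x hx y hy).2 h').cmp3_eq]

theorem cmp3_eq_sub_one {x y x' y' : P} (hne : x ≠ y) (hn : ¬ y < x)
    (h1 : y' < x' ↔ Perp x y) (h2 : Perp x' y' ↔ x < y) : cmp3 x' y' = cmp3 x y - 1 := by
  rcases lt_or_gt_or_eq_or_perp x y with h | h | h | h
  · rw [cmp3_eq_one.2 h, (h2.2 h).cmp3_eq]; decide
  · exact absurd h hn
  · exact absurd h hne
  · rw [h.cmp3_eq, cmp3_eq_neg_one.2 (h1.2 h)]; decide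

theorem IsRotation.cob3_map {f : Equiv.Perm P} (hf : IsRotation f) (a b c : P) :
    cob3 (f a) (f b) (f c) = cob3 a b c := by
  classical
  obtain ⟨X, Y, Z, hcov, hXY, hXZ, hYZ, hX, hZ, hlt, iX, iY, iZ, fXZ, fXY, fYZ⟩ := hf
  let h : P → ZMod 3 := fun p => if p ∈ X then 0 else if p ∈ Y then 1 else 2
  have hhX : ∀ p ∈ X, h p = 0 := fun p hp => by simp [h, hp]
  have hhY : ∀ p ∈ Y, h p = 1 := fun p hp => by
    simp [h, hp, Set.disjoint_right.1 hXY hp]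
  have hhZ : ∀ p ∈ Z, h p = 2 := fun p hp => by
    simp [h, Set.disjoint_right.1 hYZ hp, Set.disjoint_right.1 hXZ hp]
  have cXY : ∀ x ∈ X, ∀ y ∈ Y, cmp3 (f x) (f y) = cmp3 x y - 1 := fun x hx y hy =>
    cmp3_eq_sub_one (fun e => Set.disjoint_left.1 hXY hx (e ▸ hy))
      (fun e => Set.disjoint_right.1 hXY hy (hX e.le hx)) (fXY x hx y hy).1 (fXY x hx y hy).2
  have cYZ : ∀ y ∈ Y, ∀ z ∈ Z, cmp3 (f y) (f z) = cmp3 y z - 1 := fun y hy z hz =>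
    cmp3_eq_sub_one (fun e => Set.disjoint_left.1 hYZ hy (e ▸ hz))
      (fun e => Set.disjoint_left.1 hYZ hy (hZ e.le hz)) (fYZ y hy z hz).1 (fYZ y hy z hz).2
  have cXZ : ∀ x ∈ X, ∀ z ∈ Z, cmp3 (f x) (f z) = cmp3 x z - 2 := fun x hx z hz => by
    rw [cmp3_eq_one.2 (hlt x hx z hz), cmp3_eq_neg_one.2 (fXZ x hx z hz)]; decide
  have key : ∀ a b, cmp3 (f a) (f b) = cmp3 a b + h a - h b := by
    intro a b
    rcases hcov a with ha | ha | ha <;> rcases hcov b with hb | hb | hb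
    · rw [iX.cmp3_map ha hb, hhX a ha, hhX b hb]; ring
    · rw [cXY a ha b hb, hhX a ha, hhY b hb]; ring
    · rw [cXZ a ha b hb, hhX a ha, hhZ b hb]; ring
    · rw [cmp3_swap, cXY b hb a ha, hhX b hb, hhY a ha, cmp3_swap a b]; ring
    · rw [iY.cmp3_map ha hb, hhY a ha, hhY b hb]; ring
    · rw [cYZ a ha b hb, hhY a ha, hhZ b hb]; ring
    · rw [cmp3_swap, cXZ b hb a ha, hhX b hb, hhZ a ha, cmp3_swap a b]; ring
    · rw [cmp3_swap, cYZ b hb a ha, hhY b hb, hhZ a ha, cmp3_swap a b]; ring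
    · rw [iZ.cmp3_map ha hb, hhZ a ha, hhZ b hb]; ring
  simp only [cob3, key]
  ring

end Preservation

section Sign

variable {f : Equiv.Perm P}

theorem cob3_map_congr_perp (hE : HasExtensions P) (hf : Preserves3 f Pari) {a b x y : P}
    (hxa : Perp x a) (hxb : Perp x b) (hya : Perp y a) (hyb : Perp y b) :
    cob3 (f a) (f b) (f x) = cob3 (f a) (f b) (f y) := by
  classical
  have aux : ∀ x z : P, Perp x a → Perp x b → Perp z a → Perp z b → Perp z x →
      cob3 (f a) (f b) (f x) = cob3 (f a) (f b) (f z) := by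
    intro x z hxa hxb hza hzb hzx
    have h1 : cob3 (f b) (f x) (f z) = 0 := by
      rw [cob3_map_eq_zero_iff hf, cob3_of_perp hzb hzx, hxb.symm.cmp3_eq]
    have h2 : cob3 (f a) (f x) (f z) = 0 := by
      rw [cob3_map_eq_zero_iff hf, cob3_of_perp hza hzx, hxa.symm.cmp3_eq]
    linear_combination -cob3_cocycle (f a) (f b) (f x) (f z) + h1 - h2
  obtain ⟨z, hz⟩ := hE.exists_perp {a, b, x, y}
  simp only [Finset.mem_insert, Finset.mem_singleton, forall_eq_or_imp, forall_eq] at hz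
  obtain ⟨hza, hzb, hzx, hzy⟩ := hz
  rw [aux x z hxa hxb hza hzb hzx, aux y z hya hyb hza hzb hzy]

theorem cob3_map_congr_right (hE : HasExtensions P) (hf : Preserves3 f Pari) {a b c x y : P}
    (hab : a < b) (hac : a < c) (hbc : Perp b c)
    (hxa : Perp x a) (hxb : Perp x b) (hya : Perp y a) (hyc : Perp y c) :
    cob3 (f a) (f b) (f x) = cob3 (f a) (f c) (f y) := by
  classical
  obtain ⟨z, hz⟩ := hE.exists_perp {a, b, c}
  simp only [Finset.mem_insert, Finset.mem_singleton, forall_eq_or_imp, forall_eq] at hz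
  obtain ⟨hza, hzb, hzc⟩ := hz
  rw [cob3_map_congr_perp hE hf hxa hxb hza hzb, cob3_map_congr_perp hE hf hya hyc hza hzc]
  have h1 : cob3 (f b) (f c) (f z) = 0 := by
    rw [cob3_map_eq_zero_iff hf, cob3_of_perp hzb hzc, hbc.cmp3_eq]
  have h2 : cob3 (f a) (f b) (f c) = 0 := by
    rw [cob3_map_eq_zero_iff hf, cob3, cmp3_eq_one.2 hab, hbc.cmp3_eq, cmp3_eq_neg_one.2 hac]
    decide
  linear_combination cob3_cocycle (f a) (f b) (f c) (f z) - h1 + h2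

theorem cob3_map_congr_left (hE : HasExtensions P) (hf : Preserves3 f Pari) {a b c x y : P}
    (hac : a < c) (hbc : b < c) (hab : Perp a b)
    (hxa : Perp x a) (hxc : Perp x c) (hyb : Perp y b) (hyc : Perp y c) :
    cob3 (f a) (f c) (f x) = cob3 (f b) (f c) (f y) := by
  classical
  obtain ⟨z, hz⟩ := hE.exists_perp {a, b, c}
  simp only [Finset.mem_insert, Finset.mem_singleton, forall_eq_or_imp, forall_eq] at hz
  obtain ⟨hza, hzb, hzc⟩ := hz
  rw [cob3_map_congr_perp hE hf hxa hxc hza hzc, cob3_map_congr_perp hE hf hyb hyc hzb hzc]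
  have h1 : cob3 (f a) (f b) (f z) = 0 := by
    rw [cob3_map_eq_zero_iff hf, cob3_of_perp hza hzb, hab.cmp3_eq]
  have h2 : cob3 (f a) (f b) (f c) = 0 := by
    rw [cob3_map_eq_zero_iff hf, cob3, cmp3_eq_neg_one.2 hac, hab.cmp3_eq, cmp3_eq_one.2 hbc]
    decide
  linear_combination -cob3_cocycle (f a) (f b) (f c) (f z) + h1 - h2

theorem HasExtensions.exists_gt_perp (hE : HasExtensions P) (a c : P) (C : Finset P)
    (hC : ∀ x ∈ C, ¬ x ≤ a) : ∃ p, a < p ∧ ¬ p ≤ c ∧ ∀ x ∈ C, Perp p x := by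
  classical
  by_cases hca : c ≤ a
  · obtain ⟨p, hp, -, hpC⟩ := hE {a} ∅ C (by simp) (by simpa using hC) (by simp)
    have hap : a < p := hp a (by simp)
    exact ⟨p, hap, (hca.trans_lt hap).not_ge, hpC⟩
  · obtain ⟨p, hp, -, hpC⟩ := hE {a} ∅ (insert c C) (by simp)
      (by simpa using ⟨hca, hC⟩) (by simp)
    exact ⟨p, hp a (by simp), (hpC c (by simp)).1, fun x hx => hpC x (by simp [hx])⟩

theorem cob3_map_congr_lt (hE : HasExtensions P) (hf : Preserves3 f Pari) {a b c d x y : P}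
    (hab : a < b) (hcd : c < d)
    (hxa : Perp x a) (hxb : Perp x b) (hyc : Perp y c) (hyd : Perp y d) :
    cob3 (f a) (f b) (f x) = cob3 (f c) (f d) (f y) := by
  classical
  obtain ⟨e, hae, hec, heb⟩ := hE.exists_gt_perp a c {b} (by simpa using hab.not_ge)
  obtain ⟨e', hce', hea', hed'⟩ := hE.exists_gt_perp c a {d, e}
    (by simpa using ⟨hcd.not_ge, hec⟩)
  simp only [Finset.mem_insert, Finset.mem_singleton, forall_eq_or_imp, forall_eq] at heb hed'
  obtain ⟨h, -, hhe, hhC⟩ := hE ∅ {e, e'} {a, c} (by simp) (by simp)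
    (by simpa using ⟨⟨hae.not_ge, hea'⟩, hec, hce'.not_ge⟩)
  simp only [Finset.mem_insert, Finset.mem_singleton, forall_eq_or_imp, forall_eq] at hhe hhC
  obtain ⟨z, hz⟩ := hE.exists_perp {a, c, e, e', h}
  simp only [Finset.mem_insert, Finset.mem_singleton, forall_eq_or_imp, forall_eq] at hz
  obtain ⟨hza, hzc, hze, hze', hzh⟩ := hz
  calc cob3 (f a) (f b) (f x) = cob3 (f a) (f e) (f z) :=
        cob3_map_congr_right hE hf hab hae heb.symm hxa hxb hza hze
    _ = cob3 (f h) (f e) (f z) :=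
        cob3_map_congr_left hE hf hae hhe.1 hhC.1.symm hza hze hzh hze
    _ = cob3 (f h) (f e') (f z) :=
        cob3_map_congr_right hE hf hhe.1 hhe.2 hed'.2.symm hzh hze hzh hze'
    _ = cob3 (f c) (f e') (f z) :=
        cob3_map_congr_left hE hf hhe.2 hce' hhC.2 hzh hze' hzc hze'
    _ = cob3 (f c) (f d) (f y) :=
        cob3_map_congr_right hE hf hce' hcd hed'.1 hzc hze' hyc hyd

/-- A permutation preserving `Pari` preserves the coboundary of `cmp3` up to a global sign. -/
theorem exists_sign_cob3_map (hE : HasExtensions P) (hf : Preserves3 f Pari) :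
    ∃ e : ZMod 3, (e = 1 ∨ e = -1) ∧
      ∀ a b c : P, cob3 (f a) (f b) (f c) = e * cob3 a b c := by
  classical
  obtain ⟨p, -⟩ := hE.exists_perp ∅
  obtain ⟨q, hpq, -, -⟩ := hE.exists_gt_perp p p ∅ (by simp)
  obtain ⟨z, hz⟩ := hE.exists_perp {p, q}
  have hzp : Perp z p := hz p (by simp)
  have hzq : Perp z q := hz q (by simp)
  have he0 : cob3 (f p) (f q) (f z) ≠ 0 := by
    rw [Ne, cob3_map_eq_zero_iff hf, cob3_of_perp hzp hzq, cmp3_eq_one.2 hpq]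
    decide
  refine ⟨cob3 (f p) (f q) (f z), ?_, ?_⟩
  · revert he0
    generalize cob3 (f p) (f q) (f z) = t
    revert t
    decide
  have key : ∀ a b x : P, Perp x a → Perp x b →
      cob3 (f a) (f b) (f x) = cob3 (f p) (f q) (f z) * cmp3 a b := by
    intro a b x hxa hxb
    rcases cmp3_cases a b with h | h | h
    · rw [h, mul_one]
      exact cob3_map_congr_lt hE hf (cmp3_eq_one.1 h) hpq hxa hxb hzp hzq
    · rw [h, mul_neg_one,
        ← cob3_map_congr_lt hE hf (cmp3_eq_neg_one.1 h) hpq hxb hxa hzp hzq]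
      simp only [cob3]
      rw [cmp3_swap (f b) (f a), cmp3_swap (f b) (f x), cmp3_swap (f a) (f x)]
      ring
    · rw [h, mul_zero, cob3_map_eq_zero_iff hf, cob3_of_perp hxa hxb, h]
  intro a b c
  obtain ⟨x, hx⟩ := hE.exists_perp {a, b, c}
  simp only [Finset.mem_insert, Finset.mem_singleton, forall_eq_or_imp, forall_eq] at hx
  obtain ⟨hxa, hxb, hxc⟩ := hx
  have h1 := key b c x hxb hxc
  have h2 := key a c x hxa hxc
  have h3 := key a b x hxa hxb
  have h4 : cob3 a b c = cmp3 b c - cmp3 a c + cmp3 a b := by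
    rw [cob3, cmp3_swap a c]; ring
  rw [h4]
  linear_combination -cob3_cocycle (f a) (f b) (f c) (f x) + h1 - h2 + h3

end Sign

section Rotation

variable {f : Equiv.Perm P} {h : P → ZMod 3}

theorem lt_of_lt_of_level_left (hc : ∀ a b, cmp3 (f a) (f b) = cmp3 a b + h a - h b)
    {a a' b : P} (ha : h a = h a') (hb : h b = h a' + 1) (hlt : b < a') : b < a := by
  have h1 : f a' < f b := by
    rw [← cmp3_eq_one, hc, cmp3_eq_neg_one.2 hlt, hb]; ring_nf; decide
  have h2 : cmp3 (f a) (f b) = cmp3 a b - 1 := by rw [hc, ha, hb]; ring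
  have h3 : cmp3 (f a) (f a') = cmp3 a a' := by rw [hc, ha]; ring
  rcases lt_or_gt_or_eq_or_perp a a' with h' | h' | rfl | h'
  · rw [cmp3_eq_one.2 h', cmp3_eq_one] at h3
    rw [cmp3_eq_one.2 (h3.trans h1)] at h2
    rw [← cmp3_eq_neg_one]
    revert h2
    generalize cmp3 a b = t
    revert t
    decide
  · exact hlt.trans h'
  · exact hlt
  · rcases cmp3_cases a b with h4 | h4 | h4
    · exact absurd ((cmp3_eq_one.1 h4).trans hlt).le h'.1
    · exact cmp3_eq_neg_one.1 h4
    · rw [h4, zero_sub, cmp3_eq_neg_one] at h2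
      rw [h'.cmp3_eq, cmp3_eq_neg_one.2 (h1.trans h2)] at h3
      exact absurd h3 (by decide)

theorem lt_of_lt_of_level_right (hc : ∀ a b, cmp3 (f a) (f b) = cmp3 a b + h a - h b)
    {a b b' : P} (hb : h b = h b') (ha : h b' = h a + 1) (hlt : b' < a) : b < a := by
  have h1 : f a < f b' := by
    rw [← cmp3_eq_one, hc, cmp3_eq_neg_one.2 hlt, ha]; ring_nf; decide
  have h2 : cmp3 (f a) (f b) = cmp3 a b - 1 := by rw [hc, hb, ha]; ring
  have h3 : cmp3 (f b) (f b') = cmp3 b b' := by rw [hc, hb]; ring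
  rcases lt_or_gt_or_eq_or_perp b' b with h' | h' | rfl | h'
  · rw [cmp3_eq_neg_one.2 h', cmp3_eq_neg_one] at h3
    rw [cmp3_eq_one.2 (h1.trans h3)] at h2
    rw [← cmp3_eq_neg_one]
    revert h2
    generalize cmp3 a b = t
    revert t
    decide
  · exact h'.trans hlt
  · exact hlt
  · rcases cmp3_cases a b with h4 | h4 | h4
    · exact absurd (hlt.trans (cmp3_eq_one.1 h4)).le h'.1
    · exact cmp3_eq_neg_one.1 h4
    · rw [h4, zero_sub, cmp3_eq_neg_one] at h2
      rw [h'.symm.cmp3_eq, cmp3_eq_one.2 (h2.trans h1)] at h3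
      exact absurd h3 (by decide)

/-- Some level of `h` lies entirely above the next one, and the other two consecutive pairs of
levels contain no descent. -/
theorem exists_level (hE : HasExtensions P)
    (hc : ∀ a b, cmp3 (f a) (f b) = cmp3 a b + h a - h b) :
    ∃ k : ZMod 3, (∀ a b, h a = k → h b = k + 1 → b < a) ∧
      (∀ a b, h a = k + 1 → h b = k + 2 → ¬ b < a) ∧
      (∀ a b, h a = k + 2 → h b = k → ¬ b < a) := by
  have cov : ∀ t k : ZMod 3, t = k ∨ t = k + 1 ∨ t = k + 2 := by decide
  have e3 : ∀ k : ZMod 3, k + 1 + 1 = k + 2 ∧ k + 2 + 1 = k ∧ k + 2 + 2 = k + 1 := by decide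
  have all : ∀ k : ZMod 3, (∃ a b, h a = k ∧ h b = k + 1 ∧ b < a) →
      ∀ a b, h a = k → h b = k + 1 → b < a := by
    rintro k ⟨a', b', ha', hb', hlt⟩ a b ha hb
    exact lt_of_lt_of_level_left hc (ha.trans ha'.symm) (by rw [hb, ha'])
      (lt_of_lt_of_level_right hc (hb.trans hb'.symm) (by rw [hb', ha']) hlt)
  have two : ∀ k : ZMod 3, (∃ a b, h a = k ∧ h b = k + 1 ∧ b < a) →
      (∃ a b, h a = k + 1 ∧ h b = k + 2 ∧ b < a) → False := by
    intro k h1 h2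
    have A1 := all k h1
    have A2 := all (k + 1) (by rw [(e3 k).1]; exact h2)
    rw [(e3 k).1] at A2
    obtain ⟨a, b, ha, hb, -⟩ := h1
    classical
    obtain ⟨c, hcab⟩ := hE.exists_perp {a, b}
    have hca : Perp c a := hcab a (by simp)
    have hcb : Perp c b := hcab b (by simp)
    rcases cov (h c) k with h' | h' | h'
    · exact hcb.2 (A1 c b h' hb).le
    · exact hca.1 (A1 a c ha h').le
    · exact hcb.1 (A2 b c hb h').le
  by_cases hD : ∃ k : ZMod 3, ∃ a b, h a = k ∧ h b = k + 1 ∧ b < a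
  · obtain ⟨k, hk⟩ := hD
    refine ⟨k, all k hk, fun a b ha hb hlt => two k hk ⟨a, b, ha, hb, hlt⟩,
      fun a b ha hb hlt => two (k + 2) ⟨a, b, ha, by rw [hb, (e3 k).2.1], hlt⟩ ?_⟩
    rw [(e3 k).2.1, (e3 k).2.2]
    exact hk
  · push Not at hD
    have hempty : ∃ k : ZMod 3, ∀ a, h a ≠ k := by
      by_contra! hne
      obtain ⟨a, ha⟩ := hne 0
      obtain ⟨b, hb⟩ := hne 1
      obtain ⟨c, hc'⟩ := hne 2
      have n1 := hD 0 a b ha (by rw [hb]; decide)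
      have n2 := hD 1 b c hb (by rw [hc']; decide)
      have n3 := hD 2 c a hc' (by rw [ha]; decide)
      rw [← cmp3_eq_neg_one] at n1 n2 n3
      have d1 : cmp3 (f a) (f b) = cmp3 a b - 1 := by rw [hc, ha, hb]; ring
      have d2 : cmp3 (f b) (f c) = cmp3 b c - 1 := by rw [hc, hb, hc']; ring
      have d3 : cmp3 (f c) (f a) = cmp3 c a - 1 := by rw [hc, hc', ha]; ring_nf; congr 1
      have hcs : ∀ t : ZMod 3, t ≠ -1 → t - 1 ≠ 1 ∧ (t = 1 ∨ t - 1 = -1) := by decide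
      obtain ⟨w1, h1⟩ := hcs _ n1
      obtain ⟨w2, h2⟩ := hcs _ n2
      obtain ⟨w3, h3⟩ := hcs _ n3
      rw [← d1] at w1 h1
      rw [← d2] at w2 h2
      rw [← d3] at w3 h3
      rcases h1 with u1 | u1 <;> rcases h2 with u2 | u2 <;> rcases h3 with u3 | u3
      · exact n3 (cmp3_trans u1 u2)
      · exact n3 (cmp3_trans u1 u2)
      · exact n2 (cmp3_trans u3 u1)
      · exact w1 (cmp3_trans_neg u2 u3)
      · exact n1 (cmp3_trans u2 u3)
      · exact w2 (cmp3_trans_neg u3 u1)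
      · exact w3 (cmp3_trans_neg u1 u2)
      · exact w3 (cmp3_trans_neg u1 u2)
    obtain ⟨k, hk⟩ := hempty
    refine ⟨k, fun a b ha => absurd ha (hk a), fun a b ha hb => hD (k + 1) a b ha ?_,
      fun a b ha hb => absurd hb (hk b)⟩
    rw [hb, (e3 k).1]

theorem isRotation_of_cob3_map (hE : HasExtensions P)
    (hf : ∀ a b c, cob3 (f a) (f b) (f c) = cob3 a b c) : IsRotation f := by
  obtain ⟨p, -⟩ := hE.exists_perp ∅
  let h : P → ZMod 3 := fun x => cmp3 p x - cmp3 (f p) (f x)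
  have hc : ∀ a b, cmp3 (f a) (f b) = cmp3 a b + h a - h b := by
    intro a b
    have := hf p a b
    rw [cob3, cob3, cmp3_swap p b, cmp3_swap (f p) (f b)] at this
    simp only [h]
    linear_combination this
  obtain ⟨k, hZX, hXY, hYZ⟩ := exists_level hE hc
  have same : ∀ i : ZMod 3, BehavesLikeId f {x | h x = i} := by
    intro i x hx y hy
    have e : cmp3 (f x) (f y) = cmp3 x y := by
      rw [hc, show h x = i from hx, show h y = i from hy]; ring
    refine ⟨fun hlt => ?_, fun hp => ?_⟩
    · rwa [← cmp3_eq_one, e, cmp3_eq_one]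
    · exact perp_of_cmp3_eq_zero (by rw [e, hp.cmp3_eq]) (f.injective.ne hp.ne)
  have next : ∀ i j : ZMod 3, j = i + 1 → ∀ x y, h x = i → h y = j → ¬ y < x →
      (f y < f x ↔ Perp x y) ∧ (Perp (f x) (f y) ↔ x < y) := by
    intro i j hij x y hx hy hn
    have hne : x ≠ y := by
      rintro rfl
      rw [hx] at hy
      rw [hy] at hij
      revert hij
      clear hx hy
      revert j
      decide
    have e : cmp3 (f x) (f y) = cmp3 x y - 1 := by rw [hc, hx, hy, hij]; ring
    refine ⟨⟨fun hlt => ?_, fun hp => ?_⟩, fun hp => ?_, fun hlt => ?_⟩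
    · refine perp_of_cmp3_eq_zero ?_ hne
      rw [cmp3_eq_neg_one.2 hlt] at e
      linear_combination -e
    · rw [← cmp3_eq_neg_one, e, hp.cmp3_eq]; ring
    · rw [hp.cmp3_eq] at e
      rw [← cmp3_eq_one]
      linear_combination -e
    · exact perp_of_cmp3_eq_zero (by rw [e, cmp3_eq_one.2 hlt]; ring) (f.injective.ne hne)
  have disj : ∀ i j : ZMod 3, i ≠ j → Disjoint {x | h x = i} {x | h x = j} := fun i j hij =>
    Set.disjoint_left.2 fun x hx hy => hij (hx.symm.trans hy)
  have cov : ∀ t k : ZMod 3, t = k + 1 ∨ t = k + 2 ∨ t = k := by decide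
  have ne1 : ∀ k : ZMod 3, k + 1 ≠ k + 2 ∧ k + 1 ≠ k ∧ k + 2 ≠ k := by decide
  have e3 : ∀ k : ZMod 3, k + 2 = k + 1 + 1 ∧ k = k + 2 + 1 := by decide
  refine ⟨{x | h x = k + 1}, {x | h x = k + 2}, {x | h x = k}, fun x => cov (h x) k,
    disj _ _ (ne1 k).1, disj _ _ (ne1 k).2.1, disj _ _ (ne1 k).2.2, ?_, ?_,
    fun x hx z hz => hZX z x hz hx, same _, same _, same _, ?_, ?_, ?_⟩
  · intro x y hyx hx
    rcases hyx.lt_or_eq with hlt | rfl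
    · rcases cov (h y) k with hy | hy | hy
      · exact hy
      · exact absurd hlt (hXY x y hx hy)
      · exact absurd hlt (hZX y x hy hx).not_gt
    · exact hx
  · intro z y hzy hz
    rcases hzy.lt_or_eq with hlt | rfl
    · rcases cov (h y) k with hy | hy | hy
      · exact absurd hlt (hZX z y hz hy).not_gt
      · exact absurd hlt (hYZ y z hy hz)
      · exact hy
    · exact hz
  · intro x hx z hz
    rw [← cmp3_eq_one, hc, cmp3_eq_neg_one.2 (hZX z x hz hx), show h x = k + 1 from hx,
      show h z = k from hz]
    ring_nf
    decide
  · intro x hx y hy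
    exact next _ _ (e3 k).1 x y hx hy (hXY x y hx hy)
  · intro y hy z hz
    exact next _ _ (e3 k).2 y z hy hz (hYZ y z hy hz)

end Rotation

/-- A permutation preserves `Pari` iff it is a rotation or the composition of an
anti-automorphism with a rotation. -/
theorem preserves_pari_iff [Countable P] [Infinite P]
    (hU : IsUniversal P) (hH : IsHomogeneous P) (f : Equiv.Perm P) :
    Preserves3 (⇑f) Pari ↔
      (IsRotation f ∨
        ∃ s r : Equiv.Perm P, IsAntiAuto s ∧ IsRotation r ∧ f = s * r) := by
  have hE := hasExtensions hU hH
  constructor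
  · intro hf
    obtain ⟨e, rfl | rfl, he⟩ := exists_sign_cob3_map hE hf
    · exact Or.inl (isRotation_of_cob3_map hE fun a b c => by rw [he, one_mul])
    · obtain ⟨s, hs⟩ := exists_isAntiAuto hE
      refine Or.inr ⟨s, s⁻¹ * f, hs, isRotation_of_cob3_map hE fun a b c => ?_, by group⟩
      simp only [Equiv.Perm.mul_apply]
      rw [hs.symm.cob3_map, he]
      ring
  · rintro (hf | ⟨s, r, hs, hr, rfl⟩)
    · exact preserves3_pari_of_cob3 f fun a b c => by rw [hf.cob3_map]
    · refine preserves3_pari_of_cob3 _ fun a b c => ?_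
      simp only [Equiv.Perm.mul_apply]
      rw [hs.cob3_map, hr.cob3_map, neg_eq_zero]
end

section
/- Let 𝒢 be a closed subgroup of Sym(P) which contains every rotation of P and which is 3-transitive (for any two triples of pairwise distinct elements of P there is an element of 𝒢 mapping the first onto the second componentwise). Then 𝒢 = Sym(P). -/
variable {P : Type} [PartialOrder P]

/-- The one-point extension property: every consistent type over a finite set is realised. -/
def ExtensionProperty (P : Type) [PartialOrder P] : Prop :=
  ∀ (S : Finset P) (lo hi : P → Prop),
    (∀ a ∈ S, ∀ b ∈ S, a < b → lo b → lo a) →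
    (∀ a ∈ S, ∀ b ∈ S, a < b → hi a → hi b) →
    (∀ a ∈ S, ∀ b ∈ S, lo a → hi b → a < b) →
    ∃ z ∉ S, ∀ a ∈ S, (a < z ↔ lo a) ∧ (z < a ↔ hi a)

theorem IsHomogeneous.exists_orderIso (hH : IsHomogeneous P) (S : Finset P) (φ : P → P)
    (hφ : ∀ x ∈ S, ∀ y ∈ S, φ x ≤ φ y ↔ x ≤ y) : ∃ g : P ≃o P, ∀ x ∈ S, g x = φ x := by
  classical
  let T : Finset P := S.image φ
  let ψ : ↥(S : Set P) → ↥(T : Set P) := fun x =>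
    ⟨φ x, Finset.mem_coe.2 (Finset.mem_image_of_mem φ x.2)⟩
  have hle : ∀ x y, ψ x ≤ ψ y ↔ x ≤ y := fun x y => hφ x x.2 y y.2
  have hψ : Function.Bijective ψ := by
    constructor
    · intro x y hxy
      exact le_antisymm ((hle x y).1 hxy.le) ((hle y x).1 hxy.ge)
    · rintro ⟨y, hy⟩
      obtain ⟨x, hx, rfl⟩ := Finset.mem_image.1 (Finset.mem_coe.1 hy)
      exact ⟨⟨x, hx⟩, rfl⟩
  obtain ⟨g, hg⟩ := hH S T
    { toEquiv := Equiv.ofBijective ψ hψ, map_rel_iff' := fun {x y} => hle x y }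
  exact ⟨g, fun x hx => hg ⟨x, hx⟩⟩

theorem IsUniversal.extensionProperty (hU : IsUniversal P) (hH : IsHomogeneous P) :
    ExtensionProperty P := by
  classical
  intro S lo hi hlo hhi hlohi
  let le : Option S → Option S → Prop := fun u v => match u, v with
    | none, none => True
    | none, some b => hi b
    | some a, none => lo a
    | some a, some b => a ≤ b
  have hlo' : ∀ a b : S, a ≤ b → lo b → lo a := by
    intro a b hab hb
    rcases hab.eq_or_lt with rfl | hlt
    · exact hb
    · exact hlo a a.2 b b.2 hlt hb
  have hhi' : ∀ a b : S, a ≤ b → hi a → hi b := by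
    intro a b hab ha
    rcases hab.eq_or_lt with rfl | hlt
    · exact ha
    · exact hhi a a.2 b b.2 hlt ha
  let _ : PartialOrder (Option S) :=
    { le := le
      lt := fun u v => le u v ∧ ¬ le v u
      lt_iff_le_not_ge := fun _ _ => Iff.rfl
      le_refl := by rintro (_ | a) <;> simp [le]
      le_trans := by
        rintro (_ | a) (_ | b) (_ | c) hab hbc
        · trivial
        · exact hbc
        · trivial
        · exact hhi' b c hbc hab
        · exact hab
        · exact (hlohi a a.2 c c.2 hab hbc).le
        · exact hlo' a b hab hbc
        · exact le_trans (α := S) hab hbc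
      le_antisymm := by
        rintro (_ | a) (_ | b) hab hba
        · rfl
        · exact absurd (hlohi b b.2 b b.2 hba hab) (lt_irrefl _)
        · exact absurd (hlohi a a.2 a a.2 hab hba) (lt_irrefl _)
        · exact congrArg some (le_antisymm (α := S) hab hba) }
  obtain ⟨e⟩ := hU (Option S)
  obtain ⟨g, hg⟩ := hH.exists_orderIso S
    (fun a => if h : a ∈ S then e (some ⟨a, h⟩) else a) (by
      intro x hx y hy
      simp only [hx, hy, dif_pos, e.le_iff_le]
      exact Iff.rfl)
  have hg' : ∀ a : S, g a = e (some a) := fun a => by simp [hg a a.2]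
  have hne : ∀ a : S, (a : P) ≠ g.symm (e none) := by
    intro a ha
    have : e (some a) = e none := by rw [← hg', ha, g.apply_symm_apply]
    simpa using e.injective this
  refine ⟨g.symm (e none), fun h => hne ⟨_, h⟩ rfl, fun a ha => ?_⟩
  have h1 : a ≤ g.symm (e none) ↔ lo a := by
    rw [g.le_symm_apply, hg' ⟨a, ha⟩, e.le_iff_le]; exact Iff.rfl
  have h2 : g.symm (e none) ≤ a ↔ hi a := by
    rw [g.symm_apply_le, hg' ⟨a, ha⟩, e.le_iff_le]; exact Iff.rfl
  have h3 := hne ⟨a, ha⟩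
  exact ⟨by rw [← h1, lt_iff_le_and_ne]; exact and_iff_left h3,
    by rw [← h2, lt_iff_le_and_ne]; exact and_iff_left h3.symm⟩

/-- Two triples `(a, b, ε)` are compatible if the assignment `a ↦ b` preserves the order between
them when they have the same `ε`, and otherwise, the triple with `ε = false` being regarded as the
lower one, turns `<` into incomparability and incomparability into `>`. -/
def ShiftCompatible (u v : P × P × Bool) : Prop :=
  (u.2.2 = v.2.2 → (u.1 ≤ v.1 ↔ u.2.1 ≤ v.2.1)) ∧
    (u.2.2 = false → v.2.2 = true →
      ¬ v.1 ≤ u.1 ∧ ¬ u.2.1 ≤ v.2.1 ∧ (v.2.1 ≤ u.2.1 ↔ ¬ u.1 ≤ v.1))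

/-- `a` can be added to a partial shift containing `u` with label `ε`. -/
def ShiftAdmissible (a : P) (ε : Bool) (u : P × P × Bool) : Prop :=
  u.1 ≠ a ∧ (ε = false → u.2.2 = true → ¬ u.1 ≤ a) ∧ (ε = true → u.2.2 = false → ¬ a ≤ u.1)

/-- The second component of `u` has to lie below the image of `a`. -/
def ShiftBelow (a : P) (ε : Bool) (u : P × P × Bool) : Prop :=
  (u.2.2 = ε ∧ u.1 ≤ a) ∨ (u.2.2 = true ∧ ε = false ∧ ¬ a ≤ u.1)

/-- The second component of `u` has to lie above the image of `a`. -/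
def ShiftAbove (a : P) (ε : Bool) (u : P × P × Bool) : Prop :=
  (u.2.2 = ε ∧ a ≤ u.1) ∨ (u.2.2 = false ∧ ε = true ∧ ¬ u.1 ≤ a)

theorem ShiftCompatible.eq_of_eq {u v : P × P × Bool} (huv : ShiftCompatible u v)
    (hvu : ShiftCompatible v u) (h : u.2.1 = v.2.1) : u = v := by
  obtain ⟨a₁, b₁, ε₁⟩ := u
  obtain ⟨a₂, b₂, ε₂⟩ := v
  obtain rfl : b₁ = b₂ := h
  cases ε₁ <;> cases ε₂ <;> simp [ShiftCompatible] at huv hvu ⊢ <;> exact le_antisymm huv hvu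

theorem ShiftBelow.mono {a : P} {ε : Bool} {u v : P × P × Bool} (huv : ShiftCompatible u v)
    (hvu : ShiftCompatible v u) (ha : ShiftAdmissible a ε u) (hlt : u.2.1 ≤ v.2.1)
    (h : ShiftBelow a ε v) : ShiftBelow a ε u := by
  rcases u with ⟨a₁, b₁, _ | _⟩ <;> rcases v with ⟨a₂, b₂, _ | _⟩ <;> cases ε <;>
    simp [ShiftCompatible, ShiftAdmissible, ShiftBelow] at huv hvu ha hlt h ⊢ <;>
    grind

theorem ShiftAbove.mono {a : P} {ε : Bool} {u v : P × P × Bool} (huv : ShiftCompatible u v)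
    (hvu : ShiftCompatible v u) (ha : ShiftAdmissible a ε v) (hlt : u.2.1 ≤ v.2.1)
    (h : ShiftAbove a ε u) : ShiftAbove a ε v := by
  rcases u with ⟨a₁, b₁, _ | _⟩ <;> rcases v with ⟨a₂, b₂, _ | _⟩ <;> cases ε <;>
    simp [ShiftCompatible, ShiftAdmissible, ShiftAbove] at huv hvu ha hlt h ⊢ <;>
    grind

theorem ShiftBelow.lt {a : P} {ε : Bool} {u v : P × P × Bool} (huv : ShiftCompatible u v)
    (hvu : ShiftCompatible v u) (hau : ShiftAdmissible a ε u) (hav : ShiftAdmissible a ε v)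
    (hu : ShiftBelow a ε u) (hv : ShiftAbove a ε v) : u.2.1 < v.2.1 := by
  rw [lt_iff_le_not_ge]
  rcases u with ⟨a₁, b₁, _ | _⟩ <;> rcases v with ⟨a₂, b₂, _ | _⟩ <;> cases ε <;>
    simp [ShiftCompatible, ShiftAdmissible, ShiftBelow, ShiftAbove] at huv hvu hau hav hu hv ⊢ <;>
    grind

/-- A finite set of triples `(a, b, ε)` is a partial shift if any two of them are compatible. -/
def IsPartialShift (f : Finset (P × P × Bool)) : Prop :=
  ∀ u ∈ f, ∀ v ∈ f, ShiftCompatible u v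

open Classical in
theorem IsPartialShift.exists_insert (hE : ExtensionProperty P) {f : Finset (P × P × Bool)}
    (hf : IsPartialShift f) (a : P) (ε : Bool) (hε : ∀ u ∈ f, ShiftAdmissible a ε u) :
    ∃ b, IsPartialShift (insert (a, b, ε) f) := by
  have hinj : ∀ u ∈ f, ∀ v ∈ f, u.2.1 = v.2.1 → u = v := fun u hu v hv =>
    (hf u hu v hv).eq_of_eq (hf v hv u hu)
  obtain ⟨b, hb, hb'⟩ := hE (f.image fun u => u.2.1)
    (fun y => ∃ u ∈ f, u.2.1 = y ∧ ShiftBelow a ε u)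
    (fun y => ∃ u ∈ f, u.2.1 = y ∧ ShiftAbove a ε u)
    (by
      simp only [Finset.mem_image]
      rintro _ ⟨u, hu, rfl⟩ _ ⟨v, hv, rfl⟩ huv ⟨w, hw, hwv, h⟩
      exact ⟨u, hu, rfl, h.mono (hf u hu w hw) (hf w hw u hu) (hε u hu) (hwv ▸ huv.le)⟩)
    (by
      simp only [Finset.mem_image]
      rintro _ ⟨u, hu, rfl⟩ _ ⟨v, hv, rfl⟩ huv ⟨w, hw, hwu, h⟩
      exact ⟨v, hv, rfl, h.mono (hf w hw v hv) (hf v hv w hw) (hε v hv) (hwu ▸ huv.le)⟩)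
    (by
      rintro _ - _ - ⟨u, hu, rfl, h⟩ ⟨v, hv, rfl, h'⟩
      exact h.lt (hf u hu v hv) (hf v hv u hu) (hε u hu) (hε v hv) h')
  have key : ∀ u ∈ f, (u.2.1 ≤ b ↔ ShiftBelow a ε u) ∧ (b ≤ u.2.1 ↔ ShiftAbove a ε u) := by
    intro u hu
    have hne : u.2.1 ≠ b := fun h => hb (Finset.mem_image.2 ⟨u, hu, h⟩)
    rw [hne.le_iff_lt, hne.symm.le_iff_lt, (hb' u.2.1 (Finset.mem_image_of_mem _ hu)).1,
      (hb' u.2.1 (Finset.mem_image_of_mem _ hu)).2]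
    exact ⟨⟨fun ⟨w, hw, hwu, h⟩ => hinj w hw u hu hwu ▸ h, fun h => ⟨u, hu, rfl, h⟩⟩,
      ⟨fun ⟨w, hw, hwu, h⟩ => hinj w hw u hu hwu ▸ h, fun h => ⟨u, hu, rfl, h⟩⟩⟩
  refine ⟨b, fun u hu v hv => ?_⟩
  rcases Finset.mem_insert.1 hu with rfl | hu <;> rcases Finset.mem_insert.1 hv with rfl | hv
  · cases ε <;> simp [ShiftCompatible]
  · have h1 := key v hv
    have h2 := hε v hv
    clear hf hε hinj hb hb' key
    rcases v with ⟨a₂, b₂, _ | _⟩ <;> cases ε <;>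
      simp [ShiftCompatible, ShiftAdmissible, ShiftBelow, ShiftAbove] at h1 h2 ⊢ <;> grind
  · have h1 := key u hu
    have h2 := hε u hu
    clear hf hε hinj hb hb' key
    rcases u with ⟨a₂, b₂, _ | _⟩ <;> cases ε <;>
      simp [ShiftCompatible, ShiftAdmissible, ShiftBelow, ShiftAbove] at h1 h2 ⊢ <;> grind
  · exact hf u hu v hv

open Classical in
theorem IsPartialShift.swap {f : Finset (P × P × Bool)} (hf : IsPartialShift f) :
    IsPartialShift (f.image fun u => (u.2.1, u.1, !u.2.2)) := by
  have key : ∀ u v : P × P × Bool, ShiftCompatible u v → ShiftCompatible v u →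
      ShiftCompatible (u.2.1, u.1, !u.2.2) (v.2.1, v.1, !v.2.2) := by
    rintro ⟨a₁, b₁, _ | _⟩ ⟨a₂, b₂, _ | _⟩ <;> simp +contextual [ShiftCompatible]
  simp only [IsPartialShift, Finset.mem_image]
  rintro _ ⟨u, hu, rfl⟩ _ ⟨v, hv, rfl⟩
  exact key u v (hf u hu v hv) (hf v hv u hu)

theorem IsPartialShift.exists_left (hE : ExtensionProperty P) {f : Finset (P × P × Bool)}
    (hf : IsPartialShift f) (a : P) :
    ∃ f', IsPartialShift f' ∧ f ⊆ f' ∧ ∃ b ε, (a, b, ε) ∈ f' := by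
  classical
  by_cases h : ∃ u ∈ f, u.1 = a
  · obtain ⟨u, hu, rfl⟩ := h
    exact ⟨f, hf, subset_rfl, _, _, hu⟩
  · push Not at h
    have hadm : ∀ u ∈ f, ShiftAdmissible a (decide (∃ v ∈ f, v.2.2 = true ∧ v.1 ≤ a)) u := by
      refine fun u hu => ⟨h u hu, fun hε hu' hle => ?_, fun hε hu' hle => ?_⟩
      · exact of_decide_eq_false hε ⟨u, hu, hu', hle⟩
      · obtain ⟨v, hv, hv', hva⟩ := of_decide_eq_true hε
        exact ((hf u hu v hv).2 hu' hv').1 (hva.trans hle)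
    obtain ⟨b, hb⟩ := hf.exists_insert hE a _ hadm
    exact ⟨_, hb, Finset.subset_insert _ _, b, _, Finset.mem_insert_self _ _⟩

theorem IsPartialShift.exists_right (hE : ExtensionProperty P) {f : Finset (P × P × Bool)}
    (hf : IsPartialShift f) (b : P) :
    ∃ f', IsPartialShift f' ∧ f ⊆ f' ∧ ∃ a ε, (a, b, ε) ∈ f' := by
  classical
  obtain ⟨f', hf', hsub, a, ε, hmem⟩ := hf.swap.exists_left hE b
  refine ⟨_, hf'.swap, fun u hu => ?_, a, !ε, Finset.mem_image.2 ⟨_, hmem, rfl⟩⟩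
  exact Finset.mem_image.2 ⟨_, hsub (Finset.mem_image_of_mem _ hu), by simp⟩

/-- The partial shifts, ordered by inclusion. -/
abbrev PartialShift (P : Type) [PartialOrder P] : Type :=
  {f : Finset (P × P × Bool) // IsPartialShift f}

theorem IsPartialShift.exists_isRotation [Countable P] (hE : ExtensionProperty P)
    {f : Finset (P × P × Bool)} (hf : IsPartialShift f) :
    ∃ g : Equiv.Perm P, IsRotation g ∧ ∀ u ∈ f, g u.1 = u.2.1 := by
  classical
  have := Encodable.ofCountable P
  let D : P ⊕ P → Order.Cofinal (PartialShift P) := fun p => match p with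
    | .inl a => ⟨{f' | ∃ b ε, (a, b, ε) ∈ f'.1}, fun f' => by
        obtain ⟨f'', h, hle, hmem⟩ := f'.2.exists_left hE a
        exact ⟨⟨f'', h⟩, hmem, hle⟩⟩
    | .inr b => ⟨{f' | ∃ a ε, (a, b, ε) ∈ f'.1}, fun f' => by
        obtain ⟨f'', h, hle, hmem⟩ := f'.2.exists_right hE b
        exact ⟨⟨f'', h⟩, hmem, hle⟩⟩
  let J := Order.idealOfCofinals (⟨f, hf⟩ : PartialShift P) D
  let F : Set (P × P × Bool) := {u | ∃ f' ∈ J, u ∈ f'.1}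
  have hF : ∀ u ∈ F, ∀ v ∈ F, ShiftCompatible u v := by
    rintro u ⟨f₁, h₁, hu⟩ v ⟨f₂, h₂, hv⟩
    obtain ⟨f₃, -, h₁₃, h₂₃⟩ := J.directed f₁ h₁ f₂ h₂
    exact f₃.2 u (h₁₃ hu) v (h₂₃ hv)
  have hfF : ∀ u ∈ f, u ∈ F := fun u hu => ⟨_, Order.mem_idealOfCofinals _ _, hu⟩
  have hleft : ∀ a, ∃ b ε, (a, b, ε) ∈ F := by
    intro a
    obtain ⟨f', ⟨b, ε, h⟩, hf'⟩ :=
      Order.cofinal_meets_idealOfCofinals (⟨f, hf⟩ : PartialShift P) D (.inl a)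
    exact ⟨b, ε, f', hf', h⟩
  have hright : ∀ b, ∃ a ε, (a, b, ε) ∈ F := by
    intro b
    obtain ⟨f', ⟨a, ε, h⟩, hf'⟩ :=
      Order.cofinal_meets_idealOfCofinals (⟨f, hf⟩ : PartialShift P) D (.inr b)
    exact ⟨a, ε, f', hf', h⟩
  choose g ε hg using hleft
  have hinj : Function.Injective g := fun a a' h =>
    congrArg Prod.fst ((hF _ (hg a) _ (hg a')).eq_of_eq (hF _ (hg a') _ (hg a)) h)
  have hgF : ∀ u ∈ F, g u.1 = u.2.1 := by
    rintro ⟨a, b, η⟩ hu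
    have h1 := hF _ hu _ (hg a)
    have h2 := hF _ (hg a) _ hu
    cases η <;> rcases hε : ε a <;> simp [ShiftCompatible, hε] at h1 h2 ⊢ <;>
      exact le_antisymm h2 h1
  have hsurj : Function.Surjective g := fun b => by
    obtain ⟨a, η, h⟩ := hright b
    exact ⟨a, hgF _ h⟩
  have hsame : ∀ a a', ε a = ε a' → (g a ≤ g a' ↔ a ≤ a') := fun a a' h =>
    ((hF _ (hg a) _ (hg a')).1 h).symm
  have hdiff : ∀ a a', ε a = false → ε a' = true →
      ¬ a' ≤ a ∧ ¬ g a ≤ g a' ∧ (g a' ≤ g a ↔ ¬ a ≤ a') := fun a a' h h' =>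
    (hF _ (hg a) _ (hg a')).2 h h'
  refine ⟨Equiv.ofBijective g ⟨hinj, hsurj⟩, ?_, fun u hu => hgF u (hfF u hu)⟩
  have hid : ∀ η, BehavesLikeId g {a | ε a = η} := by
    intro η a ha a' ha'
    have h1 := hsame a a' (ha.trans ha'.symm)
    have h2 := hsame a' a (ha'.trans ha.symm)
    simp only [lt_iff_le_not_ge, Perp, h1, h2]
    exact ⟨id, id⟩
  refine ⟨{a | ε a = false}, {a | ε a = true}, ∅, ?_, ?_, by simp, by simp, ?_, ?_, by simp,
    hid _, hid _, by simp [BehavesLikeId], by simp, ?_, by simp⟩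
  · intro p
    rcases h : ε p <;> simp [h]
  · simp +contextual [Set.disjoint_left]
  · intro a a' hle ha
    by_contra ha'
    exact (hdiff a a' ha (by simpa using ha')).1 hle
  · exact isUpperSet_empty
  · intro a ha a' ha'
    obtain ⟨h1, h2, h3⟩ := hdiff a a' ha ha'
    simp only [lt_iff_le_not_ge, Perp]
    tauto

theorem exists_isPartialShift (hE : ExtensionProperty P) (S : Finset (P × Bool))
    (hS : ∀ a a', (a, false) ∈ S → (a', true) ∈ S → ¬ a' ≤ a) :
    ∃ f, IsPartialShift f ∧ (∀ p ∈ S, ∃ b, (p.1, b, p.2) ∈ f) ∧ ∀ u ∈ f, (u.1, u.2.2) ∈ S := by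
  classical
  induction S using Finset.induction_on with
  | empty => exact ⟨∅, by simp [IsPartialShift], by simp, by simp⟩
  | insert p S hp ih =>
    obtain ⟨a, ε⟩ := p
    obtain ⟨f, hf, hSf, hfS⟩ := ih fun a a' h h' =>
      hS a a' (Finset.mem_insert_of_mem h) (Finset.mem_insert_of_mem h')
    have hadm : ∀ u ∈ f, ShiftAdmissible a ε u := by
      rintro ⟨a', b', η⟩ hu
      have h1 := hfS _ hu
      have h2 := hS a a'
      have h3 := hS a' a
      cases ε <;> cases η <;> simp [ShiftAdmissible] at h1 h2 h3 ⊢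
      · rintro rfl; exact hp h1
      · exact ⟨fun h => h2 h1 h.le, h2 h1⟩
      · exact ⟨fun h => h3 h1 h.ge, h3 h1⟩
      · rintro rfl; exact hp h1
    obtain ⟨b, hb⟩ := hf.exists_insert hE a ε hadm
    refine ⟨_, hb, ?_, ?_⟩
    · intro q hq
      rcases Finset.mem_insert.1 hq with rfl | hq
      · exact ⟨b, Finset.mem_insert_self _ _⟩
      · exact (hSf q hq).imp fun _ h => Finset.mem_insert_of_mem h
    · intro u hu
      rcases Finset.mem_insert.1 hu with rfl | hu
      · exact Finset.mem_insert_self _ _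
      · exact Finset.mem_insert_of_mem (hfS u hu)

theorem exists_isRotation_of_blocks [Countable P] (hE : ExtensionProperty P) (A B : Finset P)
    (hAB : ∀ a ∈ A, ∀ b ∈ B, ¬ b ≤ a) :
    ∃ g : Equiv.Perm P, IsRotation g ∧ (∀ a ∈ A, ∀ a' ∈ A, g a ≤ g a' ↔ a ≤ a') ∧
      (∀ b ∈ B, ∀ b' ∈ B, g b ≤ g b' ↔ b ≤ b') ∧
      ∀ a ∈ A, ∀ b ∈ B, ¬ g a ≤ g b ∧ (g b ≤ g a ↔ ¬ a ≤ b) := by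
  classical
  obtain ⟨f, hf, hSf, -⟩ := exists_isPartialShift hE
    (A.image (fun a => (a, false)) ∪ B.image (fun b => (b, true))) (by
      intro a a' ha ha'
      simp at ha ha'
      exact hAB a ha a' ha')
  obtain ⟨g, hg, hgf⟩ := hf.exists_isRotation hE
  have hA : ∀ a ∈ A, (a, g a, false) ∈ f := by
    intro a ha
    obtain ⟨b, hb⟩ := hSf (a, false) (by simp [ha])
    simpa [hgf _ hb] using hb
  have hB : ∀ a ∈ B, (a, g a, true) ∈ f := by
    intro a ha
    obtain ⟨b, hb⟩ := hSf (a, true) (by simp [ha])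
    simpa [hgf _ hb] using hb
  exact ⟨g, hg, fun a ha a' ha' => ((hf _ (hA a ha) _ (hA a' ha')).1 rfl).symm,
    fun a ha a' ha' => ((hf _ (hB a ha) _ (hB a' ha')).1 rfl).symm,
    fun a ha b hb => ((hf _ (hA a ha) _ (hB b hb)).2 rfl rfl).2⟩

/-- Some member of `G` maps `s` injectively onto an antichain. -/
def Flattens (G : Subgroup (Equiv.Perm P)) (s : Set P) : Prop :=
  ∃ g ∈ G, s.Pairwise fun x y => Perp (g x) (g y)

/-- `I`, `R`, `L` are antichains, `I` lies below `R`, and `L` is incomparable to both. -/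
structure IsConfiguration (I R L : Set P) : Prop where
  left : I.Pairwise Perp
  mid : R.Pairwise Perp
  right : L.Pairwise Perp
  lt : ∀ i ∈ I, ∀ r ∈ R, i < r
  perp_left : ∀ i ∈ I, ∀ l ∈ L, Perp i l
  perp_mid : ∀ r ∈ R, ∀ l ∈ L, Perp r l

/-- Configurations with blocks of sizes `i`, `r`, `l` are flattened by `G`. -/
def FlattensSizes (G : Subgroup (Equiv.Perm P)) (i r l : ℕ) : Prop :=
  ∀ I R L : Finset P, IsConfiguration (I : Set P) R L →
    I.card = i → R.card = r → L.card = l → Flattens G (I ∪ R ∪ L : Set P)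

/-- The group `G` extends finite partial isomorphisms of `P` and rotates the blocks of
finite configurations. -/
structure IsRotationRich (G : Subgroup (Equiv.Perm P)) : Prop where
  extension : ExtensionProperty P
  exists_mem_eq : ∀ (S : Finset P) (φ : P → P),
    (∀ x ∈ S, ∀ y ∈ S, φ x ≤ φ y ↔ x ≤ y) → ∃ g ∈ G, ∀ x ∈ S, g x = φ x
  exists_shift : ∀ I R L : Finset P, IsConfiguration (I : Set P) R L →
    ∃ g ∈ G, IsConfiguration (g '' R) (g '' L) (g '' I)

instance : Std.Symm (Perp (P := P)) := ⟨fun _ _ => Perp.symm⟩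

theorem perp_iff {a b : P} : Perp a b ↔ a ≠ b ∧ ¬ a < b ∧ ¬ b < a := by
  constructor
  · exact fun h => ⟨h.ne, fun h' => h.1 h'.le, fun h' => h.2 h'.le⟩
  · rintro ⟨h1, h2, h3⟩
    exact ⟨fun h => h2 (lt_of_le_of_ne h h1), fun h => h3 (lt_of_le_of_ne h h1.symm)⟩

variable {G : Subgroup (Equiv.Perm P)}

theorem Flattens.mono {s t : Set P} (h : Flattens G t) (hst : s ⊆ t) : Flattens G s := by
  obtain ⟨g, hg, hgt⟩ := h
  exact ⟨g, hg, hgt.mono hst⟩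

theorem flattens_of_pairwise {s : Set P} (hs : s.Pairwise Perp) : Flattens G s :=
  ⟨1, G.one_mem, hs⟩

theorem Flattens.image {s : Set P} (h : Flattens G s) {g : Equiv.Perm P} (hg : g ∈ G) :
    Flattens G (g '' s) := by
  obtain ⟨f, hf, hfs⟩ := h
  refine ⟨f * g⁻¹, G.mul_mem hf (G.inv_mem hg), ?_⟩
  rintro _ ⟨x, hx, rfl⟩ _ ⟨y, hy, rfl⟩ hxy
  simpa using hfs hx hy fun h => hxy (by rw [h])

theorem flattens_image_iff {s : Set P} {g : Equiv.Perm P} (hg : g ∈ G) :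
    Flattens G (g '' s) ↔ Flattens G s := by
  refine ⟨fun h => ?_, fun h => h.image hg⟩
  have := h.image (G.inv_mem hg)
  rwa [← Set.image_comp, ← Equiv.Perm.coe_mul, inv_mul_cancel, Equiv.Perm.coe_one,
    Set.image_id] at this

theorem IsRotationRich.flattens_range (h : IsRotationRich G) {ι : Type} [Finite ι]
    {u v : ι → P} (huv : ∀ i j, v i ≤ v j ↔ u i ≤ u j) (hu : Flattens G (Set.range u)) :
    Flattens G (Set.range v) := by
  have hfac : Function.FactorsThrough v u := fun i j hij =>
    le_antisymm ((huv i j).2 hij.le) ((huv j i).2 hij.ge)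
  obtain ⟨g, hg, hgu⟩ := h.exists_mem_eq (Set.finite_range u).toFinset (Function.extend u v id) (by
    simp only [Set.Finite.mem_toFinset, Set.mem_range]
    rintro _ ⟨i, rfl⟩ _ ⟨j, rfl⟩
    rw [hfac.extend_apply, hfac.extend_apply, huv])
  have : v = g ∘ u := by
    funext i
    rw [Function.comp_apply, hgu _ (by simp), hfac.extend_apply]
  rw [this, Set.range_comp]
  exact hu.image hg

theorem IsConfiguration.mono {I R L I' R' L' : Set P} (h : IsConfiguration I R L) (hI : I' ⊆ I)
    (hR : R' ⊆ R) (hL : L' ⊆ L) : IsConfiguration I' R' L' :=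
  ⟨h.left.mono hI, h.mid.mono hR, h.right.mono hL,
    fun i hi r hr => h.lt i (hI hi) r (hR hr),
    fun i hi l hl => h.perp_left i (hI hi) l (hL hl),
    fun r hr l hl => h.perp_mid r (hR hr) l (hL hl)⟩

theorem Set.Pairwise.coe_le_iff {s : Set P} (hs : s.Pairwise Perp) (x y : s) :
    (x : P) ≤ y ↔ x = y := by
  refine ⟨fun h => ?_, fun h => h ▸ le_rfl⟩
  by_contra hne
  exact (hs x.2 y.2 fun h' => hne (Subtype.ext h')).1 h

theorem IsRotationRich.flattensSizes_iff (h : IsRotationRich G) {I R L : Finset P}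
    (hc : IsConfiguration (I : Set P) R L) :
    FlattensSizes G I.card R.card L.card ↔ Flattens G (I ∪ R ∪ L : Set P) := by
  refine ⟨fun h' => h' I R L hc rfl rfl rfl, fun hf I' R' L' hc' hI hR hL => ?_⟩
  have e₁ : I ≃ I' := Finset.equivOfCardEq hI.symm
  have e₂ : R ≃ R' := Finset.equivOfCardEq hR.symm
  have e₃ : L ≃ L' := Finset.equivOfCardEq hL.symm
  let u : I ⊕ R ⊕ L → P := Sum.elim (↑) (Sum.elim (↑) (↑))
  let v : I ⊕ R ⊕ L → P := Sum.elim (fun i => e₁ i) (Sum.elim (fun i => e₂ i) fun i => e₃ i)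
  have hu : Set.range u = (I ∪ R ∪ L : Set P) := by
    simp [u, Set.Sum.elim_range, Set.union_assoc]
  have hv : Set.range v = (I' ∪ R' ∪ L' : Set P) := by
    simp only [v, Set.Sum.elim_range]
    rw [← Function.comp_def _ e₁, ← Function.comp_def _ e₂, ← Function.comp_def _ e₃]
    simp only [EquivLike.range_comp, Subtype.range_coe_subtype, Set.union_assoc]
    rfl
  rw [← hv]
  refine h.flattens_range (u := u) ?_ (hu ▸ hf)
  rintro (x | x | x) (y | y | y)
  · exact (hc'.left.coe_le_iff (e₁ x) (e₁ y)).trans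
      (e₁.injective.eq_iff.trans (hc.left.coe_le_iff x y).symm)
  · exact iff_of_true (hc'.lt _ (e₁ x).2 _ (e₂ y).2).le (hc.lt _ x.2 _ y.2).le
  · exact iff_of_false (hc'.perp_left _ (e₁ x).2 _ (e₃ y).2).1 (hc.perp_left _ x.2 _ y.2).1
  · exact iff_of_false (hc'.lt _ (e₁ y).2 _ (e₂ x).2).not_ge (hc.lt _ y.2 _ x.2).not_ge
  · exact (hc'.mid.coe_le_iff (e₂ x) (e₂ y)).trans
      (e₂.injective.eq_iff.trans (hc.mid.coe_le_iff x y).symm)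
  · exact iff_of_false (hc'.perp_mid _ (e₂ x).2 _ (e₃ y).2).1 (hc.perp_mid _ x.2 _ y.2).1
  · exact iff_of_false (hc'.perp_left _ (e₁ y).2 _ (e₃ x).2).2 (hc.perp_left _ y.2 _ x.2).2
  · exact iff_of_false (hc'.perp_mid _ (e₂ y).2 _ (e₃ x).2).2 (hc.perp_mid _ y.2 _ x.2).2
  · exact (hc'.right.coe_le_iff (e₃ x) (e₃ y)).trans
      (e₃.injective.eq_iff.trans (hc.right.coe_le_iff x y).symm)

theorem FlattensSizes.shift (h : IsRotationRich G) {i r l : ℕ} (hf : FlattensSizes G r l i) :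
    FlattensSizes G i r l := by
  intro I R L hc hI hR hL
  obtain ⟨g, hg, hgc⟩ := h.exists_shift I R L hc
  have := hf (R.map g.toEmbedding) (L.map g.toEmbedding) (I.map g.toEmbedding)
    (by simpa using hgc) (by simpa) (by simpa) (by simpa)
  rw [← flattens_image_iff hg]
  simpa [Set.image_union, Set.union_comm, Set.union_left_comm, Set.union_assoc] using this

theorem IsRotationRich.flattensSizes_rotate (h : IsRotationRich G) {i r l : ℕ} :
    FlattensSizes G i r l ↔ FlattensSizes G r l i :=
  ⟨fun hf => (hf.shift h).shift h, fun hf => hf.shift h⟩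

theorem FlattensSizes.of_zero (r l : ℕ) : FlattensSizes G 0 r l := by
  intro I R L hc hI _ _
  obtain rfl := Finset.card_eq_zero.1 hI
  rw [Finset.coe_empty, Set.empty_union]
  refine flattens_of_pairwise (Set.pairwise_union_of_symm.2
    ⟨hc.mid, hc.right, fun x hx y hy _ => hc.perp_mid x hx y hy⟩)

theorem exists_isConfiguration {A : Finset P} {R : Set P} (hA : (A : Set P).Pairwise Perp)
    (hR : R.Pairwise Perp) (hne : R.Nonempty) (hAR : Disjoint (A : Set P) R)
    (hu : ∀ a ∈ A, ∀ r ∈ R, ∀ r' ∈ R, (a < r → a < r') ∧ (r < a → r' < a)) :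
    ∃ J L : Finset P, (J ∪ L : Set P) = A ∧ (IsConfiguration (J : Set P) R L ∨
      IsConfiguration R (J : Set P) L) := by
  classical
  obtain ⟨r₀, hr₀⟩ := hne
  have hneq : ∀ a ∈ A, ∀ r ∈ R, a ≠ r := fun a ha r hr => hAR.ne_of_mem ha hr
  by_cases hD : ∃ d ∈ A, r₀ < d
  · obtain ⟨d, hd, hrd⟩ := hD
    refine ⟨A.filter (r₀ < ·), A.filter (¬ r₀ < ·), by ext; simp; tauto, Or.inr
      ⟨hR, hA.mono (Finset.coe_subset.2 (Finset.filter_subset _ _)),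
      hA.mono (Finset.coe_subset.2 (Finset.filter_subset _ _)), ?_, ?_, ?_⟩⟩
    · intro r hr a ha
      simp only [Finset.coe_filter, Set.mem_ofPred_eq] at ha
      exact (hu a ha.1 r₀ hr₀ r hr).2 ha.2
    · intro r hr a ha
      simp only [Finset.coe_filter, Set.mem_ofPred_eq] at ha
      refine perp_iff.2 ⟨(hneq a ha.1 r hr).symm, fun h => ha.2 ((hu a ha.1 r hr r₀ hr₀).2 h),
        fun h => ?_⟩
      have had : a < d := ((hu a ha.1 r hr r₀ hr₀).1 h).trans hrd
      exact (hA ha.1 hd had.ne).1 had.le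
    · intro a ha b hb
      simp only [Finset.coe_filter, Set.mem_ofPred_eq] at ha hb
      exact hA ha.1 hb.1 (by rintro rfl; exact hb.2 ha.2)
  · push Not at hD
    refine ⟨A.filter (· < r₀), A.filter (¬ · < r₀), by ext; simp; tauto, Or.inl
      ⟨hA.mono (Finset.coe_subset.2 (Finset.filter_subset _ _)), hR,
      hA.mono (Finset.coe_subset.2 (Finset.filter_subset _ _)), ?_, ?_, ?_⟩⟩
    · intro a ha r hr
      simp only [Finset.coe_filter, Set.mem_ofPred_eq] at ha
      exact (hu a ha.1 r₀ hr₀ r hr).1 ha.2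
    · intro a ha b hb
      simp only [Finset.coe_filter, Set.mem_ofPred_eq] at ha hb
      exact hA ha.1 hb.1 (by rintro rfl; exact hb.2 ha.2)
    · intro r hr a ha
      simp only [Finset.coe_filter, Set.mem_ofPred_eq] at ha
      exact perp_iff.2 ⟨(hneq a ha.1 r hr).symm,
        fun h => hD a ha.1 ((hu a ha.1 r hr r₀ hr₀).2 h),
        fun h => ha.2 ((hu a ha.1 r hr r₀ hr₀).1 h)⟩

theorem ExtensionProperty.exists_above_even (hE : ExtensionProperty P) (N : ℕ) (r : ℕ → P)
    (hr : ∀ i ≤ N, ∀ j ≤ N, i ≠ j → Perp (r i) (r j)) :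
    ∃ x, (∀ i ≤ N, Even i → r i < x) ∧ ∀ i ≤ N, ¬ Even i → Perp x (r i) := by
  classical
  have hinj : ∀ i ≤ N, ∀ j ≤ N, r i = r j → i = j := fun i hi j hj h => by
    by_contra hne
    exact (hr i hi j hj hne).ne h
  obtain ⟨x, hx, hxr⟩ := hE ((Finset.range (N + 1)).image r)
    (fun a => ∃ i ≤ N, Even i ∧ r i = a) (fun _ => False) (by
      simp only [Finset.mem_image, Finset.mem_range, Nat.lt_succ_iff]
      rintro _ ⟨i, hi, rfl⟩ _ ⟨j, hj, rfl⟩ hij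
      exact absurd hij.le (hr i hi j hj (by rintro rfl; exact lt_irrefl _ hij)).1)
    (by simp) (by simp)
  have hmem : ∀ i ≤ N, r i ∈ (Finset.range (N + 1)).image r := fun i hi =>
    Finset.mem_image_of_mem r (Finset.mem_range.2 (Nat.lt_succ_of_le hi))
  refine ⟨x, fun i hi hev => (hxr _ (hmem i hi)).1.2 ⟨i, hi, hev, rfl⟩, fun i hi hod => ?_⟩
  refine perp_iff.2 ⟨fun h => hx (h ▸ hmem i hi), (hxr _ (hmem i hi)).2.1, fun h => ?_⟩
  obtain ⟨j, hj, hev, hji⟩ := (hxr _ (hmem i hi)).1.1 h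
  exact hod (hinj j hj i hi hji ▸ hev)

/-- A point whose relation to a long chain of images is constant makes a configuration of the
excluded sizes flattenable. -/
theorem IsRotationRich.not_uniform_on_chain (h : IsRotationRich G) {k n : ℕ} (hk : k ≤ n)
    (hT : ¬ FlattensSizes G k 1 (n - k)) {g : Equiv.Perm P} (hg : g ∈ G) (r : ℕ → P) (x : P)
    (hr : ∀ i < 2 * n, ∀ j < 2 * n, i ≠ j → Perp (r i) (r j))
    (hev : ∀ i < 2 * n, Even i → r i < x) (hod : ∀ i < 2 * n, ¬ Even i → Perp x (r i))
    (hg' : ∀ i < 2 * n, ∀ j < 2 * n, i < j → g (r i) < g (r j))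
    (hu : (∀ i < 2 * n, g x < g (r i)) ∨ (∀ i < 2 * n, g (r i) < g x) ∨
      ∀ i < 2 * n, Perp (g x) (g (r i))) : False := by
  classical
  let t : Fin n → ℕ := fun i => if (i : ℕ) < k then 2 * i else 2 * i + 1
  have ht : ∀ i : Fin n, t i < 2 * n := fun i => by dsimp only [t]; split_ifs <;> omega
  have htlt : ∀ i j : Fin n, i < j → t i < t j := fun i j hij => by
    have : (i : ℕ) < j := hij
    dsimp only [t]; split_ifs <;> omega
  have hs : ∀ i : Fin n, 2 * (i : ℕ) + 1 < 2 * n := fun i => by omega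
  have hle : ∀ i < 2 * n, ∀ j < 2 * n, g (r i) ≤ g (r j) ↔ i ≤ j := by
    intro i hi j hj
    rcases lt_trichotomy i j with hij | rfl | hij
    · exact iff_of_true (hg' i hi j hj hij).le hij.le
    · simp
    · exact iff_of_false (hg' j hj i hi hij).not_ge (by omega)
  have htle : ∀ i j : Fin n, t i ≤ t j ↔ 2 * (i : ℕ) + 1 ≤ 2 * j + 1 := by
    intro i j
    rcases lt_trichotomy i j with hij | rfl | hij
    · have : (i : ℕ) < j := hij
      exact iff_of_true (htlt i j hij).le (by omega)
    · simp
    · have : (j : ℕ) < i := hij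
      exact iff_of_false (htlt j i hij).not_ge (by omega)
  have hux : ∀ i < 2 * n, ∀ j < 2 * n, (g x ≤ g (r i) ↔ g x ≤ g (r j)) ∧
      (g (r i) ≤ g x ↔ g (r j) ≤ g x) := by
    intro i hi j hj
    rcases hu with hu | hu | hu
    · exact ⟨iff_of_true (hu i hi).le (hu j hj).le,
        iff_of_false (hu i hi).not_ge (hu j hj).not_ge⟩
    · exact ⟨iff_of_false (hu i hi).not_ge (hu j hj).not_ge,
        iff_of_true (hu i hi).le (hu j hj).le⟩
    · exact ⟨iff_of_false (hu i hi).1 (hu j hj).1, iff_of_false (hu i hi).2 (hu j hj).2⟩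
  let a : Option (Fin n) → P := fun o => o.elim x fun i => r (2 * i + 1)
  let b : Option (Fin n) → P := fun o => o.elim x fun i => r (t i)
  have hodd : ∀ i : ℕ, ¬ Even (2 * i + 1) := fun i => by simp
  have ha : Flattens G (Set.range a) := by
    refine flattens_of_pairwise ?_
    rintro _ ⟨i, rfl⟩ _ ⟨j, rfl⟩ hij
    rcases i with _ | i <;> rcases j with _ | j
    · exact absurd rfl hij
    · exact hod _ (hs j) (hodd j)
    · exact (hod _ (hs i) (hodd i)).symm
    · refine hr _ (hs i) _ (hs j) fun h' => hij ?_
      simp only [a, Option.elim, h']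
  have hb : Flattens G (Set.range b) := by
    rw [← flattens_image_iff hg, ← Set.range_comp]
    refine h.flattens_range (u := g ∘ a) ?_ (by rw [Set.range_comp]; exact ha.image hg)
    rintro (_ | i) (_ | j)
    · simp [a, b]
    · exact (hux _ (ht j) _ (hs j)).1
    · exact (hux _ (ht i) _ (hs i)).2
    · exact (hle _ (ht i) _ (ht j)).trans ((htle i j).trans (hle _ (hs i) _ (hs j)).symm)
  have hinj : Function.Injective fun i => r (t i) := by
    intro i j hij
    by_contra hne
    refine (hr _ (ht i) _ (ht j) fun h' => hne ?_).ne hij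
    have h1 := htle i j
    have h2 := htle j i
    exact Fin.ext (by omega)
  have hpair : (Set.range fun i => r (t i)).Pairwise Perp := by
    rintro _ ⟨i, rfl⟩ _ ⟨j, rfl⟩ hij
    exact hr _ (ht i) _ (ht j) fun h' => hij (congrArg r h')
  let K := (Finset.univ.filter fun i : Fin n => (i : ℕ) < k).image fun i => r (t i)
  let L := (Finset.univ.filter fun i : Fin n => ¬ (i : ℕ) < k).image fun i => r (t i)
  have hK : ∀ y ∈ K, ∃ i : Fin n, (i : ℕ) < k ∧ r (t i) = y := by simp [K]
  have hL : ∀ y ∈ L, ∃ i : Fin n, ¬ (i : ℕ) < k ∧ r (t i) = y := by simp [L]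
  have hcK : (Finset.univ.filter fun i : Fin n => (i : ℕ) < k).card = k := by
    rw [Fin.card_filter_val_lt, min_eq_right hk]
  have hKc : K.card = k := by
    rw [Finset.card_image_of_injective _ hinj, hcK]
  have hLc : L.card = n - k := by
    have := Finset.card_filter_add_card_filter_not (s := (Finset.univ : Finset (Fin n)))
      (fun i : Fin n => (i : ℕ) < k)
    rw [Finset.card_image_of_injective _ hinj]
    rw [hcK, Finset.card_univ, Fintype.card_fin] at this
    omega
  have hc : IsConfiguration (K : Set P) ({x} : Finset P) L := by
    refine ⟨hpair.mono ?_, by simp, hpair.mono ?_, ?_, ?_, ?_⟩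
    · intro y hy
      obtain ⟨i, -, rfl⟩ := hK y hy
      exact ⟨i, rfl⟩
    · intro y hy
      obtain ⟨i, -, rfl⟩ := hL y hy
      exact ⟨i, rfl⟩
    · intro y hy z hz
      obtain rfl : z = x := by simpa using hz
      obtain ⟨i, hi, rfl⟩ := hK y hy
      refine hev _ (ht i) ?_
      simp [t, hi]
    · intro y hy z hz
      obtain ⟨i, hi, rfl⟩ := hK y hy
      obtain ⟨j, hj, rfl⟩ := hL z hz
      refine hpair ⟨i, rfl⟩ ⟨j, rfl⟩ fun h' => ?_
      have := hinj h'
      subst this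
      exact hj hi
    · intro z hz y hy
      obtain rfl : z = x := by simpa using hz
      obtain ⟨i, hi, rfl⟩ := hL y hy
      refine hod _ (ht i) ?_
      simp only [t, hi, if_false]
      exact hodd i
  refine hT ?_
  have := (h.flattensSizes_iff hc).2 (hb.mono ?_)
  · rwa [hKc, hLc, Finset.card_singleton] at this
  · rintro y ((hy | hy) | hy)
    · obtain ⟨i, -, rfl⟩ := hK y hy
      exact ⟨some i, rfl⟩
    · exact ⟨none, (Finset.mem_singleton.1 hy).symm⟩
    · obtain ⟨i, -, rfl⟩ := hL y hy
      exact ⟨some i, rfl⟩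

theorem IsRotationRich.not_chain (h : IsRotationRich G) {k n : ℕ} (hk : k ≤ n)
    (hT : ¬ FlattensSizes G k 1 (n - k)) {g : Equiv.Perm P} (hg : g ∈ G) (r : ℕ → P)
    (hr : ∀ i ≤ 6 * n, ∀ j ≤ 6 * n, i ≠ j → Perp (r i) (r j)) :
    ¬ ∀ i j, i < j → j ≤ 6 * n → g (r i) < g (r j) := by
  intro hg'
  obtain ⟨x, hev, hod⟩ := h.extension.exists_above_even (6 * n) r hr
  have hmono : ∀ i j, i ≤ j → j ≤ 6 * n → g (r i) ≤ g (r j) := by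
    intro i j hij hj
    rcases hij.eq_or_lt with rfl | hij
    · exact le_rfl
    · exact (hg' i j hij hj).le
  have hne : ∀ i ≤ 6 * n, g x ≠ g (r i) := by
    intro i hi h'
    have hxi := g.injective h'
    by_cases hi' : Even i
    · exact (hev i hi hi').ne hxi.symm
    · exact (hod i hi hi').ne hxi
  have block : ∀ b ≤ 4 * n, Even b → ¬ ((∀ i < 2 * n, g x < g (r (b + i))) ∨
      (∀ i < 2 * n, g (r (b + i)) < g x) ∨ ∀ i < 2 * n, Perp (g x) (g (r (b + i)))) := by
    intro b hb hbe
    refine fun hu => h.not_uniform_on_chain hk hT hg (fun i => r (b + i)) x ?_ ?_ ?_ ?_ hu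
    · exact fun i hi j hj hij => hr _ (by omega) _ (by omega) (by omega)
    · exact fun i hi hi' => hev _ (by omega) (hbe.add hi')
    · exact fun i hi hi' => hod _ (by omega) (by rw [Nat.even_add]; tauto)
    · exact fun i hi j hj hij => hg' _ _ (by omega) (by omega)
  by_cases h1 : g x < g (r (4 * n))
  · exact block (4 * n) le_rfl ⟨2 * n, by ring⟩
      (Or.inl fun i hi => h1.trans_le (hmono _ _ (by omega) (by omega)))
  by_cases h2 : g (r (2 * n)) < g x
  · exact block 0 (Nat.zero_le _) Even.zero
      (Or.inr (Or.inl fun i hi => (hmono _ _ (by omega) (by omega)).trans_lt h2))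
  · refine block (2 * n) (by omega) ⟨n, by ring⟩
      (Or.inr (Or.inr fun i hi => perp_iff.2 ⟨hne _ (by omega), fun h' => h1 ?_, fun h' => h2 ?_⟩))
    · exact h'.trans_le (hmono _ _ (by omega) (by omega))
    · exact (hmono _ _ (by omega) (by omega)).trans_lt h'

theorem IsRotationRich.exists_subseq_perp (h : IsRotationRich G) {k n : ℕ} (hk : k ≤ n)
    (hT : ¬ FlattensSizes G k 1 (n - k)) {g : Equiv.Perm P} (hg : g ∈ G) (r : ℕ → P)
    (hr : ∀ i j, i ≠ j → Perp (r i) (r j)) :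
    ∃ φ : ℕ ↪o ℕ, ∀ i j, i ≠ j → Perp (g (r (φ i))) (g (r (φ j))) := by
  obtain ⟨φ, hφ | hφ⟩ := exists_increasing_or_nonincreasing_subseq (· < ·) fun i => g (r i)
  · refine absurd (fun i j hij _ => hφ i j hij) (h.not_chain hk hT hg (fun i => r (φ i)) ?_)
    exact fun i _ j _ hij => hr _ _ (φ.injective.ne hij)
  obtain ⟨ψ, hψ | hψ⟩ := exists_increasing_or_nonincreasing_subseq (· > ·) fun i => g (r (φ i))
  · refine absurd (fun i j hij hj => ?_)
      (h.not_chain hk hT hg (fun i => r (φ (ψ (6 * n - i)))) ?_)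
    · exact hψ _ _ (by omega)
    · exact fun i _ j _ hij => hr _ _ (φ.injective.ne (ψ.injective.ne (by omega)))
  refine ⟨ψ.trans φ, fun i j hij => ?_⟩
  have hlt : ∀ i j, i < j → Perp (g (r (φ (ψ i)))) (g (r (φ (ψ j)))) := fun i j hij =>
    perp_iff.2 ⟨g.injective.ne (hr _ _ (φ.injective.ne (ψ.injective.ne hij.ne))).ne,
      hφ _ _ (ψ.lt_iff_lt.2 hij), hψ i j hij⟩
  rcases lt_or_gt_of_ne hij with hij | hij
  · exact hlt i j hij
  · exact (hlt j i hij).symm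

theorem IsRotationRich.exists_isConfiguration_image (h : IsRotationRich G) {k n : ℕ} (hk : k ≤ n)
    (hn : 0 < n) (hT : ¬ FlattensSizes G k 1 (n - k)) {A : Finset P} (hA : Flattens G A)
    (r : ℕ → P) (hr : ∀ i j, i ≠ j → Perp (r i) (r j)) (hrA : ∀ i, r i ∉ A) :
    ∃ g ∈ G, ∃ J R L : Finset P, (J ∪ L : Set P) = A ∧ (R : Set P) ⊆ Set.range r ∧
      R.card = n ∧ IsConfiguration (g '' J) (g '' R) (g '' L) := by
  classical
  obtain ⟨g, hg, hgA⟩ := hA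
  obtain ⟨φ, hφ⟩ := h.exists_subseq_perp hk hT hg r hr
  obtain ⟨c, hc⟩ := Finite.exists_infinite_fiber fun i : ℕ =>
    (({a | g a < g (r (φ i))}, {a | g (r (φ i)) < g a}) : Set A × Set A)
  obtain ⟨N, hN, hNc⟩ := (Set.infinite_coe_iff.1 hc).exists_subset_card_eq n
  have hinj : Function.Injective fun i => r (φ i) := fun i j hij => by
    by_contra hne
    exact (hr _ _ (φ.injective.ne hne)).ne hij
  let R := N.image fun i => r (φ i)
  have hRc : R.card = n := by rw [Finset.card_image_of_injective _ hinj, hNc]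
  have hRr : (R : Set P) ⊆ Set.range r := by
    intro y hy
    obtain ⟨i, -, rfl⟩ := Finset.mem_image.1 hy
    exact ⟨φ i, rfl⟩
  have hfib : ∀ i ∈ N, ∀ j ∈ N, ∀ a ∈ A, (g a < g (r (φ i)) ↔ g a < g (r (φ j))) ∧
      (g (r (φ i)) < g a ↔ g (r (φ j)) < g a) := by
    intro i hi j hj a ha
    have hij := (hN hi : _ = c).trans (hN hj : _ = c).symm
    have h1 := congrArg (fun p : Set A × Set A => (⟨a, ha⟩ : A) ∈ p.1) hij
    have h2 := congrArg (fun p : Set A × Set A => (⟨a, ha⟩ : A) ∈ p.2) hij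
    exact ⟨iff_of_eq h1, iff_of_eq h2⟩
  obtain ⟨J', L', hJL, hconf⟩ := exists_isConfiguration (A := A.map g.toEmbedding) (R := g '' R)
    (by
      simp only [Finset.coe_map, Equiv.coe_toEmbedding]
      rintro _ ⟨x, hx, rfl⟩ _ ⟨y, hy, rfl⟩ hxy
      exact hgA hx hy fun h' => hxy (by rw [h']))
    (by
      rintro _ ⟨x, hx, rfl⟩ _ ⟨y, hy, rfl⟩ hxy
      obtain ⟨i, -, rfl⟩ := Finset.mem_image.1 hx
      obtain ⟨j, -, rfl⟩ := Finset.mem_image.1 hy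
      exact hφ i j fun h' => hxy (by rw [h']))
    (by
      obtain ⟨y, hy⟩ := Finset.card_pos.1 (hRc ▸ hn)
      exact ⟨g y, y, hy, rfl⟩)
    (by
      simp only [Finset.coe_map, Equiv.coe_toEmbedding]
      refine (Set.disjoint_image_iff g.injective).2 (Set.disjoint_left.2 fun y hyA hy => ?_)
      obtain ⟨i, rfl⟩ := hRr hy
      exact hrA i hyA)
    (by
      simp only [Finset.mem_map, Equiv.coe_toEmbedding]
      rintro _ ⟨a, ha, rfl⟩ _ ⟨x, hx, rfl⟩ _ ⟨y, hy, rfl⟩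
      obtain ⟨i, hi, rfl⟩ := Finset.mem_image.1 hx
      obtain ⟨j, hj, rfl⟩ := Finset.mem_image.1 hy
      exact ⟨(hfib i hi j hj a ha).1.1, (hfib i hi j hj a ha).2.1⟩)
  have pull : ∀ S : Finset P, g '' (S.map (Equiv.toEmbedding g⁻¹) : Finset P) = S := by
    intro S
    ext y
    simp
  have hJL' : (J'.map (Equiv.toEmbedding g⁻¹) ∪ L'.map (Equiv.toEmbedding g⁻¹) : Set P) = A := by
    apply g.injective.image_injective
    rw [Set.image_union, pull, pull, hJL]
    simp
  rcases hconf with hconf | hconf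
  · refine ⟨g, hg, _, R, _, hJL', hRr, hRc, ?_⟩
    rwa [pull, pull]
  · obtain ⟨g₁, hg₁, h₁⟩ := h.exists_shift (R.map g.toEmbedding) J' L' (by simpa using hconf)
    obtain ⟨g₂, hg₂, h₂⟩ := h.exists_shift (J'.map g₁.toEmbedding) (L'.map g₁.toEmbedding)
      ((R.map g.toEmbedding).map g₁.toEmbedding) (by simpa using h₁)
    refine ⟨g₂ * g₁ * g, G.mul_mem (G.mul_mem hg₂ hg₁) hg, L'.map (Equiv.toEmbedding g⁻¹), R,
      J'.map (Equiv.toEmbedding g⁻¹), by rwa [Set.union_comm], hRr, hRc, ?_⟩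
    simp only [Equiv.Perm.coe_mul, Set.image_comp, pull]
    simpa using h₂

theorem Finset.exists_card_eq_not_subset {α : Type} [DecidableEq α] {M J : Finset α}
    (hM : (M ∩ J).Nonempty) (hJ : ¬ J ⊆ M) :
    ∃ I ⊆ J, I.card = (M ∩ J).card ∧ ¬ M ∩ J ⊆ I := by
  obtain ⟨a, ha⟩ := hM
  obtain ⟨b, hb, hbM⟩ := Finset.not_subset.1 hJ
  have hbM' : b ∉ M ∩ J := fun h => hbM (Finset.mem_inter.1 h).1
  refine ⟨insert b ((M ∩ J).erase a), ?_, ?_, fun h => ?_⟩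
  · intro x hx
    rcases Finset.mem_insert.1 hx with rfl | hx
    · exact hb
    · exact (Finset.mem_inter.1 (Finset.mem_of_mem_erase hx)).2
  · rw [Finset.card_insert_of_notMem fun h => hbM' (Finset.mem_of_mem_erase h),
      Finset.card_erase_add_one ha]
  · rcases Finset.mem_insert.1 (h ha) with rfl | h'
    · exact hbM' ha
    · exact Finset.notMem_erase a _ h'

/-- A configuration cannot distinguish a proper part `M` of its outer blocks by sizes alone. -/
theorem IsRotationRich.not_flattensSizes_iff (h : IsRotationRich G) {k n : ℕ} (hkn : k + 1 < n)
    (hk : 0 < k) {J R L M : Finset P} (hJL : Disjoint J L) (hM : (M : Set P) ⊆ J ∪ L)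
    (hMc : M.card = k + 1) (hc : J.card + L.card = n) (hR : R.card = n)
    (hT : ¬ FlattensSizes G k 1 (n - k))
    (key : ∀ I ⊆ J, ∀ S ⊆ R, ∀ U ⊆ L, I.card + S.card + U.card = n + 1 →
      (FlattensSizes G I.card S.card U.card ↔ ¬ (M : Set P) ⊆ I ∪ U)) : False := by
  classical
  have hsplit : (M ∩ J).card + (M ∩ L).card = k + 1 := by
    rw [← hMc, ← Finset.card_union_of_disjoint (hJL.mono Finset.inter_subset_right
      Finset.inter_subset_right), ← Finset.inter_union_distrib_left,
      Finset.inter_eq_left.2 fun x hx => Finset.mem_union.2 (hM hx)]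
  have hMJL : ∀ x ∈ M, x ∈ J ∨ x ∈ L := fun x hx => hM hx
  have hdis : ∀ x ∈ J, x ∉ L := fun x hx hx' => Finset.disjoint_left.1 hJL hx hx'
  obtain ⟨S, hSR, hS⟩ := Finset.exists_subset_card_eq (s := R) (n := n - k) (by omega)
  have hbad : ¬ FlattensSizes G (M ∩ J).card (n - k) (M ∩ L).card := by
    rw [← hS, key _ Finset.inter_subset_right _ hSR _ Finset.inter_subset_right (by omega)]
    simp only [not_not]
    intro x hx
    simpa [Finset.mem_coe.1 hx] using hMJL x hx
  have hJ : (M ∩ J).Nonempty → J ⊆ M := by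
    intro hne
    by_contra hJM
    obtain ⟨I, hIJ, hI, hMI⟩ := Finset.exists_card_eq_not_subset hne hJM
    refine hbad ?_
    rw [← hS, ← hI, key I hIJ S hSR _ Finset.inter_subset_right (by omega)]
    refine fun hsub => hMI fun x hx => ?_
    obtain ⟨hxM, hxJ⟩ := Finset.mem_inter.1 hx
    exact (hsub hxM).resolve_right fun h' => hdis x hxJ (Finset.mem_inter.1 h').2
  have hL : (M ∩ L).Nonempty → L ⊆ M := by
    intro hne
    by_contra hLM
    obtain ⟨U, hUL, hU, hMU⟩ := Finset.exists_card_eq_not_subset hne hLM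
    refine hbad ?_
    rw [← hS, ← hU, key _ Finset.inter_subset_right S hSR U hUL (by omega)]
    refine fun hsub => hMU fun x hx => ?_
    obtain ⟨hxM, hxL⟩ := Finset.mem_inter.1 hx
    exact (hsub hxM).resolve_left fun h' => hdis x (Finset.mem_inter.1 h').2 hxL
  by_cases hJ0 : (M ∩ J).Nonempty
  · by_cases hL0 : (M ∩ L).Nonempty
    · rw [Finset.inter_eq_right.2 (hJ hJ0), Finset.inter_eq_right.2 (hL hL0)] at hsplit
      omega
    · rw [Finset.not_nonempty_iff_eq_empty] at hL0
      have hMJ : M ⊆ J := fun x hx => (hMJL x hx).resolve_right fun h' =>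
        Finset.notMem_empty x (hL0 ▸ Finset.mem_inter.2 ⟨hx, h'⟩)
      obtain rfl : M = J := hMJ.antisymm (hJ hJ0)
      obtain ⟨j, hj⟩ : M.Nonempty := Finset.card_pos.1 (by omega)
      obtain ⟨l, hl⟩ : L.Nonempty := Finset.card_pos.1 (by omega)
      obtain ⟨S₁, hSR₁, hS₁⟩ := Finset.exists_subset_card_eq (s := R) (n := k + 1) (by omega)
      obtain ⟨S₂, hSR₂, hS₂⟩ := Finset.exists_subset_card_eq (s := R) (n := L.card) (by omega)
      have h1 := (key {j} (by simpa) S₁ hSR₁ L subset_rfl (by simp; omega)).2 (by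
        intro hsub
        have : M ⊆ {j} := fun x hx => by
          simpa using (hsub hx).resolve_right (hdis x hx)
        have := Finset.card_le_card this
        rw [Finset.card_singleton] at this
        omega)
      have h2 := mt (key M subset_rfl S₂ hSR₂ {l} (by simpa) (by simp; omega)).1
        (not_not.2 Set.subset_union_left)
      rw [Finset.card_singleton, hS₁] at h1
      rw [Finset.card_singleton, hS₂, hMc] at h2
      exact h2 (h.flattensSizes_rotate.1 h1)
  · have hMJ0 := Finset.not_nonempty_iff_eq_empty.1 hJ0
    have hML : M ⊆ L := fun x hx => (hMJL x hx).resolve_left fun h' =>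
      Finset.notMem_empty x (hMJ0 ▸ Finset.mem_inter.2 ⟨hx, h'⟩)
    have hMne : M.Nonempty := Finset.card_pos.1 (by omega)
    obtain rfl : M = L := hML.antisymm (hL (by rwa [Finset.inter_eq_left.2 hML]))
    obtain ⟨j, hj⟩ : J.Nonempty := Finset.card_pos.1 (by omega)
    obtain ⟨U, hUL, hU⟩ := Finset.exists_subset_card_eq (s := M) (n := k) (by omega)
    have h1 := (key {j} (by simpa) S hSR U hUL (by simp; omega)).2 (by
      intro hsub
      have : M ⊆ U := fun x hx => (hsub hx).resolve_left fun h' => by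
        obtain rfl : x = j := by simpa using h'
        exact hdis x hj hx
      have := Finset.card_le_card this
      omega)
    rw [Finset.card_singleton, hS, hU] at h1
    exact hT (h1.shift h)

theorem IsRotationRich.exists_seq_perp (h : IsRotationRich G) (M : Finset P) :
    ∃ r : ℕ → P, (∀ i j, i ≠ j → Perp (r i) (r j)) ∧ ∀ i, ∀ m ∈ M, Perp m (r i) := by
  classical
  obtain ⟨r, hrM, hr⟩ := exists_seq_of_forall_finset_exists (fun y => ∀ m ∈ M, Perp m y) Perp (by
    intro S _
    obtain ⟨z, hz, hzS⟩ := h.extension (S ∪ M) (fun _ => False) (fun _ => False) (by simp) (by simp)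
      (by simp)
    have hp : ∀ a ∈ S ∪ M, Perp a z := fun a ha =>
      perp_iff.2 ⟨fun h' => hz (h' ▸ ha), (hzS a ha).1.1, (hzS a ha).2.1⟩
    exact ⟨z, fun m hm => hp m (Finset.mem_union_right _ hm),
      fun m hm => hp m (Finset.mem_union_left _ hm)⟩)
  refine ⟨r, fun i j hij => ?_, hrM⟩
  rcases lt_or_gt_of_ne hij with hij | hij
  · exact hr i j hij
  · exact (hr j i hij).symm

/-- In an extremal configuration, the obstructing block `K ∪ {x}` detects which sets of the
critical size are flattened. -/
theorem IsRotationRich.flattens_iff_not_subset (h : IsRotationRich G) {k n : ℕ} {K : Finset P}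
    {x : P} {U : Set P} (hc : IsConfiguration (K : Set P) {x} U) (hK : K.card = k)
    (hT : ¬ FlattensSizes G k 1 (n - k)) (hmin : ∀ i < k, FlattensSizes G i 1 (n - i))
    (s : Finset P) (hs : (s : Set P) ⊆ insert x K ∪ U) (hsc : s.card = n + 1) :
    Flattens G s ↔ ¬ insert x (K : Set P) ⊆ s := by
  classical
  have hxK : x ∉ K := fun hx => lt_irrefl _ (hc.lt x hx x rfl)
  have hKU : ∀ y ∈ K, y ∉ U := fun y hy hy' => (hc.perp_left y hy y hy').ne rfl
  have hxU : x ∉ U := fun hx => (hc.perp_mid x rfl x hx).ne rfl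
  by_cases hx : x ∈ s
  · have hconf : IsConfiguration ((s ∩ K : Finset P) : Set P) ({x} : Finset P)
        ((s \ insert x K : Finset P) : Set P) := by
      refine hc.mono ?_ (by simp) fun y hy => ?_
      · exact fun y hy => (Finset.mem_inter.1 hy).2
      · obtain ⟨hys, hyK⟩ := Finset.mem_sdiff.1 hy
        exact (hs hys).resolve_left fun h' => hyK (by simpa using h')
    have hsplit : (((s ∩ K : Finset P) : Set P) ∪ ({x} : Finset P) ∪
        ((s \ insert x K : Finset P) : Set P)) = s := by
      ext y
      by_cases hy : y = x
      · subst hy; simp [hx]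
      · simp [hy]; tauto
    have hiff := h.flattensSizes_iff hconf
    have hcard : (s ∩ K).card + (s \ insert x K).card = n := by
      have h1 : s ∩ insert x K = insert x (s ∩ K) := Finset.inter_insert_of_mem hx
      have h2 := Finset.card_inter_add_card_sdiff s (insert x K)
      rw [h1, Finset.card_insert_of_notMem fun h' => hxK (Finset.mem_inter.1 h').2, hsc] at h2
      omega
    rw [hsplit, Finset.card_singleton, show (s \ insert x K).card = n - (s ∩ K).card by omega]
      at hiff
    rw [← hiff, Set.insert_subset_iff, Finset.coe_subset, ← Finset.inter_eq_right]
    by_cases hsK : s ∩ K = K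
    · simpa [hsK, hK, hx] using hT
    · have hlt : (s ∩ K).card < k :=
        hK ▸ Finset.card_lt_card (Finset.inter_subset_right.ssubset_of_ne hsK)
      exact iff_of_true (hmin _ hlt) fun h' => hsK h'.2
  · refine iff_of_true (flattens_of_pairwise (Set.Pairwise.mono (s := (K ∪ U : Set P)) ?_ ?_))
      fun h' => hx (h' (Set.mem_insert x _))
    · intro y hy
      rcases hs hy with (rfl | hyK) | hyU
      · exact absurd hy hx
      · exact Or.inl hyK
      · exact Or.inr hyU
    · exact Set.pairwise_union_of_symm.2
        ⟨hc.left, hc.right, fun a ha b hb _ => hc.perp_left a ha b hb⟩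

theorem IsRotationRich.flattensSizes_one (h : IsRotationRich G) {n : ℕ} (hn : 3 ≤ n)
    (hA : ∀ s : Finset P, s.card = n → Flattens G s) (k : ℕ) (hk : k ≤ n) :
    FlattensSizes G k 1 (n - k) := by
  classical
  induction k using Nat.strong_induction_on with
  | _ k ih =>
  have hmin : ∀ i < k, FlattensSizes G i 1 (n - i) := fun i hi => ih i hi (by omega)
  by_contra hT
  have hk0 : 0 < k := by
    rcases Nat.eq_zero_or_pos k with rfl | hk0
    · exact absurd (FlattensSizes.of_zero _ _) hT
    · exact hk0
  have hk1 : k + 1 < n := by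
    by_contra hk1
    obtain rfl | hk2 : k = n ∨ k + 1 = n := by omega
    · refine hT ?_
      rw [Nat.sub_self]
      exact h.flattensSizes_rotate.1 (FlattensSizes.of_zero _ _)
    · have := hmin 1 (by omega)
      rw [show n - 1 = k by omega] at this
      rw [show n - k = 1 by omega] at hT
      exact hT (this.shift h)
  have hT' := hT
  simp only [FlattensSizes, not_forall] at hT'
  obtain ⟨K, X, L₀, hc₀, hKc, hXc, -⟩ := hT'
  obtain ⟨x, rfl⟩ := Finset.card_eq_one.1 hXc
  rw [Finset.coe_singleton] at hc₀
  obtain ⟨r, hr, hrM⟩ := h.exists_seq_perp (insert x K)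
  have hinj : Function.Injective r := fun i j hij => by
    by_contra hne
    exact (hr i j hne).ne hij
  have hrM' : ∀ i, r i ∉ insert x K := fun i hi => (hrM i _ hi).ne rfl
  have hconf : IsConfiguration (K : Set P) {x} (Set.range r) := by
    refine ⟨hc₀.left, hc₀.mid, ?_, hc₀.lt, ?_, ?_⟩
    · rintro _ ⟨i, rfl⟩ _ ⟨j, rfl⟩ hij
      exact hr i j fun h' => hij (congrArg r h')
    · rintro a ha _ ⟨i, rfl⟩
      exact hrM i a (Finset.mem_insert_of_mem ha)
    · rintro a rfl _ ⟨i, rfl⟩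
      exact hrM i a (Finset.mem_insert_self _ _)
  have hMc : (insert x K).card = k + 1 := by
    rw [Finset.card_insert_of_notMem fun hx => lt_irrefl _ (hc₀.lt x hx x rfl), hKc]
  let A := insert x K ∪ (Finset.range (n - k - 1)).image r
  have hAc : A.card = n := by
    rw [Finset.card_union_of_disjoint, hMc, Finset.card_image_of_injective _ hinj,
      Finset.card_range]
    · omega
    · refine Finset.disjoint_right.2 fun y hy => ?_
      obtain ⟨i, -, rfl⟩ := Finset.mem_image.1 hy
      exact hrM' i
  have hrA : ∀ i, r (n - k - 1 + i) ∉ A := by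
    intro i hi
    rcases Finset.mem_union.1 hi with hi | hi
    · exact hrM' _ hi
    · obtain ⟨j, hj, hji⟩ := Finset.mem_image.1 hi
      have := hinj hji
      have := Finset.mem_range.1 hj
      omega
  obtain ⟨g, hg, J, R, L, hJL, hRr, hRc, hgc⟩ := h.exists_isConfiguration_image hk (by omega) hT
    (hA A hAc) (fun i => r (n - k - 1 + i)) (fun i j hij => hr _ _ (by omega)) hrA
  have hdJL : Disjoint J L := Finset.disjoint_left.2 fun y hyJ hyL =>
    (hgc.perp_left _ ⟨y, hyJ, rfl⟩ _ ⟨y, hyL, rfl⟩).ne rfl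
  have hJLA : J ∪ L = A := Finset.coe_injective (by rw [Finset.coe_union, hJL])
  have hRA : Disjoint R A := Finset.disjoint_left.2 fun y hyR hyA => by
    obtain ⟨i, rfl⟩ := hRr hyR
    exact hrA i hyA
  have hMA : ((insert x K : Finset P) : Set P) ⊆ A := Finset.coe_subset.2 Finset.subset_union_left
  refine h.not_flattensSizes_iff hk1 hk0 hdJL (hJL ▸ hMA) hMc
    (by rw [← Finset.card_union_of_disjoint hdJL, hJLA, hAc]) hRc hT fun I hI S hS U hU hISU => ?_
  have hIA : I ⊆ A := hJLA ▸ hI.trans Finset.subset_union_left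
  have hUA : U ⊆ A := hJLA ▸ hU.trans Finset.subset_union_right
  have hcIU : IsConfiguration (I.map g.toEmbedding : Set P) (S.map g.toEmbedding : Finset P)
      (U.map g.toEmbedding : Finset P) := by
    simp only [Finset.coe_map, Equiv.coe_toEmbedding]
    exact hgc.mono (Set.image_mono hI) (Set.image_mono hS) (Set.image_mono hU)
  have h1 := h.flattensSizes_iff hcIU
  simp only [Finset.card_map, Finset.coe_map, Equiv.coe_toEmbedding, ← Set.image_union] at h1
  rw [h1, flattens_image_iff hg]
  have hcard : (I ∪ S ∪ U).card = n + 1 := by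
    rw [Finset.card_union_of_disjoint, Finset.card_union_of_disjoint, hISU]
    · exact (hRA.mono hS hIA).symm
    · exact Finset.disjoint_union_left.2 ⟨hdJL.mono hI hU, hRA.mono hS hUA⟩
  have h2 := h.flattens_iff_not_subset hconf hKc hT hmin (I ∪ S ∪ U) ?_ hcard
  · rw [Finset.coe_union, Finset.coe_union] at h2
    rw [h2, Finset.coe_insert]
    refine not_congr ⟨fun h' y hy => ?_, fun h' y hy => ?_⟩
    · rcases h' hy with (hy' | hy') | hy'
      · exact Or.inl hy'
      · exact absurd (hMA (by simpa using hy)) (Finset.disjoint_left.1 hRA (hS hy'))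
      · exact Or.inr hy'
    · exact (h' hy).elim (fun hy' => Or.inl (Or.inl hy')) Or.inr
  · have hAr : (A : Set P) ⊆ insert x (K : Set P) ∪ Set.range r := by
      intro y hy
      rcases Finset.mem_union.1 hy with hy | hy
      · exact Or.inl (by simpa using hy)
      · obtain ⟨i, -, rfl⟩ := Finset.mem_image.1 hy
        exact Or.inr ⟨i, rfl⟩
    intro y hy
    rcases Finset.mem_union.1 hy with hy | hy
    · rcases Finset.mem_union.1 hy with hy | hy
      · exact hAr (hIA hy)
      · obtain ⟨i, rfl⟩ := hRr (hS hy)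
        exact Or.inr ⟨_, rfl⟩
    · exact hAr (hUA hy)

theorem IsRotationRich.flattens_succ (h : IsRotationRich G) {n : ℕ} (hn : 3 ≤ n)
    (hA : ∀ s : Finset P, s.card = n → Flattens G s) (s : Finset P) (hs : s.card = n + 1) :
    Flattens G s := by
  classical
  obtain ⟨x, hx⟩ : s.Nonempty := Finset.card_pos.1 (by omega)
  obtain ⟨g, hg, hgs⟩ := hA (s.erase x) (by rw [Finset.card_erase_of_mem hx, hs]; rfl)
  have hAc : ((s.erase x).map g.toEmbedding).card = n := by
    rw [Finset.card_map, Finset.card_erase_of_mem hx, hs]; rfl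
  obtain ⟨J, L, hJL, hc⟩ := exists_isConfiguration (A := (s.erase x).map g.toEmbedding)
    (R := {g x})
    (by
      simp only [Finset.coe_map, Equiv.coe_toEmbedding]
      rintro _ ⟨a, ha, rfl⟩ _ ⟨b, hb, rfl⟩ hab
      exact hgs ha hb fun h' => hab (by rw [h']))
    (Set.pairwise_singleton _ _) (Set.singleton_nonempty _) (by simp)
    (by rintro a - _ rfl _ rfl; exact ⟨id, id⟩)
  have himg : g '' s = {g x} ∪ (J ∪ L : Set P) := by
    rw [hJL, Finset.coe_map, Equiv.coe_toEmbedding, ← Set.image_singleton, ← Set.image_union,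
      Finset.coe_erase, Set.union_sdiff_self, Set.union_eq_right.2 (by simpa)]
  have hcard : Disjoint J L → J.card + L.card = n := fun hd => by
    rw [← Finset.card_union_of_disjoint hd, ← hAc]
    exact congrArg _ (Finset.coe_injective (by rw [Finset.coe_union, hJL]))
  rw [← flattens_image_iff hg, himg]
  rw [← Finset.coe_singleton] at hc ⊢
  rcases hc with hc | hc
  · have hJLc := hcard (Finset.disjoint_left.2 fun y hyJ hyL => (hc.perp_left y hyJ y hyL).ne rfl)
    rw [← Set.union_assoc, Set.union_comm _ (J : Set P)]
    refine h.flattensSizes_one hn hA J.card (by omega) J _ L hc rfl (Finset.card_singleton _) ?_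
    omega
  · have hJLc := hcard (Finset.disjoint_left.2 fun y hyJ hyL => (hc.perp_mid y hyJ y hyL).ne rfl)
    rw [← Set.union_assoc]
    have := h.flattensSizes_one hn hA L.card (by omega)
    rw [show n - L.card = J.card by omega] at this
    exact h.flattensSizes_rotate.1 (h.flattensSizes_rotate.1 (h.flattensSizes_rotate.1
      (h.flattensSizes_rotate.1 this))) _ _ _ hc (Finset.card_singleton _) rfl rfl

theorem IsRotationRich.flattens_finset (h : IsRotationRich G)
    (h3 : ∀ s : Finset P, s.card = 3 → Flattens G s) (s : Finset P) (hs : 3 ≤ s.card) :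
    Flattens G s := by
  obtain ⟨m, hm⟩ : ∃ m, s.card = m := ⟨_, rfl⟩
  rw [hm] at hs
  induction m, hs using Nat.le_induction generalizing s with
  | base => exact h3 s hm
  | succ n hn ih => exact h.flattens_succ hn ih s hm

theorem IsRotationRich.of_isRotation [Countable P] (hU : IsUniversal P) (hH : IsHomogeneous P)
    (hG : ∀ f : Equiv.Perm P, IsRotation f → f ∈ G) : IsRotationRich G where
  extension := hU.extensionProperty hH
  exists_mem_eq S φ hφ := by
    obtain ⟨g, hg⟩ := hH.exists_orderIso S φ hφ
    refine ⟨g.toEquiv, hG _ ⟨Set.univ, ∅, ∅, ?_⟩, hg⟩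
    simp [isLowerSet_univ, isUpperSet_empty, BehavesLikeId, Perp]
  exists_shift I R L hc := by
    classical
    obtain ⟨g, hg, h₁, h₂, h₃⟩ := exists_isRotation_of_blocks
      (hU.extensionProperty hH) (I ∪ L) R (by
      intro a ha b hb
      rcases Finset.mem_union.1 ha with ha | ha
      · exact (hc.lt a ha b hb).not_ge
      · exact (hc.perp_mid b hb a ha).1)
    have hI : ∀ i ∈ I, i ∈ I ∪ L := fun i hi => Finset.mem_union_left _ hi
    have hL : ∀ i ∈ L, i ∈ I ∪ L := fun i hi => Finset.mem_union_right _ hi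
    have hA : ∀ a ∈ I ∪ L, ∀ a' ∈ I ∪ L, Perp a a' → Perp (g a) (g a') := fun a ha a' ha' h' =>
      ⟨mt (h₁ a ha a' ha').1 h'.1, mt (h₁ a' ha' a ha).1 h'.2⟩
    refine ⟨g, hG g hg, ?_, ?_, ?_, ?_, ?_, ?_⟩
    · rintro _ ⟨a, ha, rfl⟩ _ ⟨b, hb, rfl⟩ hab
      have := hc.mid ha hb fun h' => hab (by rw [h'])
      exact ⟨mt (h₂ a ha b hb).1 this.1, mt (h₂ b hb a ha).1 this.2⟩
    · rintro _ ⟨a, ha, rfl⟩ _ ⟨b, hb, rfl⟩ hab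
      exact hA a (hL a ha) b (hL b hb) (hc.right ha hb fun h' => hab (by rw [h']))
    · rintro _ ⟨a, ha, rfl⟩ _ ⟨b, hb, rfl⟩ hab
      exact hA a (hI a ha) b (hI b hb) (hc.left ha hb fun h' => hab (by rw [h']))
    · rintro _ ⟨a, ha, rfl⟩ _ ⟨b, hb, rfl⟩
      have := h₃ b (hL b hb) a ha
      exact lt_of_le_not_ge (this.2.2 (hc.perp_mid a ha b hb).2) this.1
    · rintro _ ⟨a, ha, rfl⟩ _ ⟨b, hb, rfl⟩
      have := h₃ b (hI b hb) a ha
      exact ⟨fun h' => this.2.1 h' (hc.lt b hb a ha).le, this.1⟩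
    · rintro _ ⟨a, ha, rfl⟩ _ ⟨b, hb, rfl⟩
      exact hA a (hL a ha) b (hI b hb) (hc.perp_left b hb a ha).symm

theorem IsRotationRich.flattens_of_card_eq_three (h : IsRotationRich G)
    (h3 : ∀ a b : Fin 3 → P, Function.Injective a → Function.Injective b →
      ∃ g ∈ G, ∀ i : Fin 3, (g : Equiv.Perm P) (a i) = b i) (s : Finset P) (hs : s.card = 3) :
    Flattens G s := by
  obtain ⟨r, hr, -⟩ := h.exists_seq_perp ∅
  obtain ⟨g, hg, hgr⟩ := h3 (fun i => (s.equivFinOfCardEq hs).symm i) (fun i => r i)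
    (Subtype.val_injective.comp (Equiv.injective _)) (fun i j hij => by
      by_contra hne
      exact (hr i j fun h' => hne (Fin.ext h')).ne hij)
  have hg' : ∀ x (hx : x ∈ s), g x = r (s.equivFinOfCardEq hs ⟨x, hx⟩) := fun x hx => by
    rw [← hgr, Equiv.symm_apply_apply]
  refine ⟨g, hg, fun x hx y hy hxy => ?_⟩
  change Perp (g x) (g y)
  rw [hg' x hx, hg' y hy]
  refine hr _ _ fun h' => hxy ?_
  exact congrArg Subtype.val ((s.equivFinOfCardEq hs).injective (Fin.ext h'))

theorem IsRotationRich.eq_top [Infinite P] (h : IsRotationRich G) (hG : IsClosedSubgroup G)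
    (hF : ∀ s : Finset P, 3 ≤ s.card → Flattens G s) : G = ⊤ := by
  refine eq_top_iff.2 fun f _ => hG f fun S => ?_
  obtain ⟨S', hSS', hS'⟩ := Infinite.exists_superset_card_eq S (S.card + 3) (by omega)
  obtain ⟨g₁, hg₁, h₁⟩ := hF S' (by omega)
  obtain ⟨g₂, hg₂, h₂⟩ := hF (S'.map f.toEmbedding) (by rw [Finset.card_map]; omega)
  obtain ⟨e, he, hes⟩ := h.exists_mem_eq (S'.map g₁.toEmbedding) (fun y => g₂ (f (g₁⁻¹ y))) (by
    simp only [Finset.mem_map, Equiv.coe_toEmbedding]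
    rintro _ ⟨x, hx, rfl⟩ _ ⟨y, hy, rfl⟩
    simp only [Equiv.Perm.inv_def, Equiv.symm_apply_apply]
    by_cases hxy : x = y
    · simp [hxy]
    · exact iff_of_false (h₂ (by simpa) (by simpa) (f.injective.ne hxy)).1 (h₁ hx hy hxy).1)
  refine ⟨g₂⁻¹ * e * g₁, G.mul_mem (G.mul_mem (G.inv_mem hg₂) he) hg₁, fun x hx => ?_⟩
  have := hes (g₁ x) (Finset.mem_map_of_mem g₁.toEmbedding (hSS' hx))
  simp [this]

/-- A 3-transitive closed group containing all rotations is the full symmetric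
group. -/
theorem three_transitive_with_rotations_is_sym [Countable P] [Infinite P]
    (hU : IsUniversal P) (hH : IsHomogeneous P)
    (G : Subgroup (Equiv.Perm P)) (hG : IsClosedSubgroup G)
    (hT : ∀ f : Equiv.Perm P, IsRotation f → f ∈ G)
    (h3 : ∀ a b : Fin 3 → P, Function.Injective a → Function.Injective b →
      ∃ g ∈ G, ∀ i : Fin 3, (g : Equiv.Perm P) (a i) = b i) :
    G = ⊤ := by
  have h := IsRotationRich.of_isRotation hU hH hT
  exact h.eq_top hG (h.flattens_finset (h.flattens_of_card_eq_three h3))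
end
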